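/- Under the hypotheses of the WCGA recovery theorem for uniformly bounded orthonormal systems with 1 < p ≤ 2 (D_N uniformly bounded by B and orthonormal in L_2(Ω,μ); u := ⌈(1 + c(2V)^{p'}(ln(2Vv))) v^{1/(p−1)}⌉ ≤ N with p' = p/(p−1); ξ^1,…,ξ^m the points with m ≤ C u log N · (log(2u))² · (log(2u) + log log N) provided there), the WCGA residual satisfies ‖f_u‖_{L_p(Ω,μ)} ≤ C' σ_v(f_0, D_N)_{L_p(Ω,μ_ξ)}, where C' is a positive absolute constant and μ_ξ := (μ + μ_m)/2 = (1/2)μ + (1/(2m)) Σ_{j=1}^m δ_{ξ^j}. -/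

import Mathlib

open MeasureTheory Finset
open scoped ENNReal NNReal BigOperators

noncomputable section

attribute [local instance] Classical.propDecidable

namespace SamplingRecovery

/-- The `L_p(μ)` norm of a complex-valued function, `1 ≤ p < ∞`. -/
def lpNorm {X : Type*} [MeasurableSpace X] (μ : Measure X) (p : ℝ) (f : X → ℂ) : ℝ :=
  (∫ x, ‖f x‖ ^ p ∂μ) ^ (1 / p)

/-- The discrete `L_p(Ω_m, μ_m)` norm associated with sample points `ξ`. -/
def dNorm {X : Type*} {m : ℕ} (ξ : Fin m → X) (p : ℝ) (f : X → ℂ) : ℝ :=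
  ((m : ℝ)⁻¹ * ∑ j, ‖f (ξ j)‖ ^ p) ^ (1 / p)

/-- The uniform norm of a function. -/
def supNorm {X : Type*} (f : X → ℂ) : ℝ := ⨆ x, ‖f x‖

/-- `Σ_v(D)`: the set of all `v`-term linear combinations with respect to the system `g`. -/
def SigmaSet {X ι : Type*} (g : ι → X → ℂ) (v : ℕ) : Set (X → ℂ) :=
  {f | ∃ (B : Finset ι) (c : ι → ℂ), B.card ≤ v ∧ f = fun x => ∑ i ∈ B, c i * g i x}

/-- `Σ_v` restricted to indices in a finite set `T`. -/
def SigmaSetOn {X ι : Type*} (g : ι → X → ℂ) (T : Finset ι) (v : ℕ) : Set (X → ℂ) :=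
  {f | ∃ (B : Finset ι) (c : ι → ℂ), B ⊆ T ∧ B.card ≤ v ∧ f = fun x => ∑ i ∈ B, c i * g i x}

/-- `σ_v(f, D)_X`: the best `v`-term approximation error of `f` with respect to the
system `g`, measured in the (semi)norm `nrm`. -/
def sigmaErr {X ι : Type*} (nrm : (X → ℂ) → ℝ) (g : ι → X → ℂ) (v : ℕ) (f : X → ℂ) : ℝ :=
  sInf ((fun h => nrm (f - h)) '' SigmaSet g v)

/-- `σ_v(f, D)` with the system restricted to indices in `T`. -/
def sigmaErrOn {X ι : Type*} (nrm : (X → ℂ) → ℝ) (g : ι → X → ℂ) (T : Finset ι)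
    (v : ℕ) (f : X → ℂ) : ℝ :=
  sInf ((fun h => nrm (f - h)) '' SigmaSetOn g T v)

/-- The `(v,S)`-incoherence property with parameters `V > 0` and `r > 0` in the
(semi)norm `nrm`. -/
def Incoherent {X ι : Type*} (g : ι → X → ℂ) (v S : ℕ) (V r : ℝ)
    (nrm : (X → ℂ) → ℝ) : Prop :=
  ∀ (A B : Finset ι), A ⊆ B → A.card ≤ v → B.card ≤ S →
    ∀ c : ι → ℂ,
      ∑ i ∈ A, ‖c i‖ ≤ V * (A.card : ℝ) ^ r * nrm (fun x => ∑ i ∈ B, c i * g i x)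

/-- `(v,S)`-unconditionality with parameter `U` in the (semi)norm `nrm`. -/
def Unconditional {X ι : Type*} (g : ι → X → ℂ) (v S : ℕ) (U : ℝ)
    (nrm : (X → ℂ) → ℝ) : Prop :=
  ∀ (A B : Finset ι), A ⊆ B → A.card ≤ v → B.card ≤ S →
    ∀ c : ι → ℂ,
      nrm (fun x => ∑ i ∈ A, c i * g i x) ≤ U * nrm (fun x => ∑ i ∈ B, c i * g i x)

/-- The points `ξ` provide `L_p`-universal sampling discretization for the collection
`X_u(D_N)` of `u`-term subspaces generated by the system `g`. -/
def USD {X : Type*} [MeasurableSpace X] (μ : Measure X) (p : ℝ) {ι : Type*} {m : ℕ}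
    (g : ι → X → ℂ) (u : ℕ) (ξ : Fin m → X) : Prop :=
  ∀ f ∈ SigmaSet g u,
    (1 / 2 : ℝ) * (∫ x, ‖f x‖ ^ p ∂μ) ≤ (m : ℝ)⁻¹ * ∑ j, ‖f (ξ j)‖ ^ p ∧
    (m : ℝ)⁻¹ * ∑ j, ‖f (ξ j)‖ ^ p ≤ (3 / 2 : ℝ) * (∫ x, ‖f x‖ ^ p ∂μ)

/-- The measure `μ_ξ = (1/2) μ + (1/(2m)) ∑_j δ_{ξ^j}`. -/
def sampleMeasure {X : Type*} [MeasurableSpace X] (μ : Measure X) {m : ℕ}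
    (ξ : Fin m → X) : Measure X :=
  (1 / 2 : ℝ≥0∞) • μ + ((2 * m : ℝ≥0∞))⁻¹ • ∑ j, Measure.dirac (ξ j)

/-- A realization of the Weak Chebyshev Greedy Algorithm with weakness parameter `t`
applied to `f0` with respect to the system `g`, in the space with (semi)norm `nrm`:
`G k` is the approximant after `k` iterations (`f_k = f0 - G k` is the residual),
`φ k` the element of the system chosen at step `k+1`.  At each step a norming
functional `F` of the residual is used (a linear functional of norm `≤ 1` with
`F(f_k) = ‖f_k‖`), the new element `g (φ k)` satisfies the weakness condition
`|F(g (φ k))| ≥ t ⬝ sup_i |F(g i)|`, and `G (k+1)` is a best approximant to `f0`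
from the span of the chosen elements. -/
def IsWCGA {X ι : Type*} (g : ι → X → ℂ) (nrm : (X → ℂ) → ℝ) (t : ℝ)
    (f0 : X → ℂ) (φ : ℕ → ι) (G : ℕ → X → ℂ) : Prop :=
  G 0 = 0 ∧
  ∀ k : ℕ,
    (∃ F : (X → ℂ) →ₗ[ℂ] ℂ,
      (∀ h, ‖F h‖ ≤ nrm h) ∧
      F (f0 - G k) = ((nrm (f0 - G k) : ℝ) : ℂ) ∧
      ∀ i, t * ‖F (g i)‖ ≤ ‖F (g (φ k))‖) ∧
    G (k + 1) ∈ Submodule.span ℂ ((fun j => g (φ j)) '' Set.Iic k) ∧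
    ∀ h ∈ Submodule.span ℂ ((fun j => g (φ j)) '' Set.Iic k),
      nrm (f0 - G (k + 1)) ≤ nrm (f0 - h)

/-- The dyadic shell `{k ∈ ℤ^d : [2^{j-1}] ≤ ‖k‖_∞ < 2^j}` as a finite set. -/
def shell (d j : ℕ) : Finset (Fin d → ℤ) :=
  (Finset.Icc (fun _ => -(2 ^ j : ℤ)) fun _ => (2 ^ j : ℤ)).filter
    fun k => (if j = 0 then (0 : ℝ) else (2 : ℝ) ^ (j - 1)) ≤ ‖k‖ ∧ ‖k‖ < (2 : ℝ) ^ j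

/-- The discrete ball `{k ∈ ℤ^d : ‖k‖_∞ < n}` as a finite set. -/
def lball (d n : ℕ) : Finset (Fin d → ℤ) :=
  (Finset.Icc (fun _ => -(n : ℤ)) fun _ => (n : ℤ)).filter fun k => ‖k‖ < (n : ℝ)

/-- The class `A^r_β(Ψ)`: functions admitting an absolutely convergent expansion
`f = ∑_k a_k ψ_k` with `(∑_{[2^{j-1}] ≤ ‖k‖_∞ < 2^j} |a_k|^β)^{1/β} ≤ 2^{-rj}` for all `j`. -/
def ArClass {X : Type*} {d : ℕ} (ψ : (Fin d → ℤ) → X → ℂ) (β r : ℝ) : Set (X → ℂ) :=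
  {f | ∃ a : (Fin d → ℤ) → ℂ,
    Summable (fun k => ‖a k‖) ∧
    (∀ x, HasSum (fun k => a k * ψ k x) (f x)) ∧
    ∀ j : ℕ, (∑ k ∈ shell d j, ‖a k‖ ^ β) ^ (1 / β) ≤ (2 : ℝ) ^ (-(r * j))}

/-- `ϱ_m^o(F, X)`: the optimal sampling recovery error of a class `F` from `m` point
values, measured in the (semi)norm `nrm`; the recovery maps `M` are arbitrary. -/
def optRecovery {X : Type*} (F : Set (X → ℂ)) (m : ℕ) (nrm : (X → ℂ) → ℝ) : ℝ :=
  ⨅ (ξ : Fin m → X), ⨅ (M : (Fin m → ℂ) → X → ℂ),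
    ⨆ f ∈ F, nrm (f - M fun j => f (ξ j))

/-- The Kolmogorov width `d_n(F, E)` of a set `F` in a space with (semi)norm `nrm`. -/
def kWidth {E : Type*} [AddCommGroup E] [Module ℂ E] (nrm : E → ℝ) (F : Set E)
    (n : ℕ) : ℝ :=
  ⨅ u : Fin n → E, ⨆ f ∈ F, ⨅ c : Fin n → ℂ, nrm (f - ∑ i, c i • u i)

/-- Normalized Lebesgue measure on the cube `[0, 2π)^d`, representing `𝕋^d`. -/
def torusMeasure (d : ℕ) : Measure (Fin d → ℝ) :=
  (ENNReal.ofReal ((2 * Real.pi) ^ d))⁻¹ •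
    volume.restrict (Set.univ.pi fun _ => Set.Ico (0 : ℝ) (2 * Real.pi))

/-- The trigonometric monomial `e^{i(k,x)}` on `𝕋^d`. -/
def trig {d : ℕ} (k : Fin d → ℤ) (x : Fin d → ℝ) : ℂ :=
  Complex.exp (Complex.I * ((∑ j, (k j : ℝ) * x j : ℝ) : ℂ))

end SamplingRecovery

open SamplingRecovery

/-- Number of iterations `u = ⌈(1 + c (2V)^{p'} ln(2Vv)) v^{1/(p-1)}⌉`, `p' = p/(p-1)`. -/
def uONS (c V p : ℝ) (v : ℕ) : ℕ :=
  ⌈(1 + c * (2 * V) ^ (p / (p - 1)) * Real.log (2 * V * v)) * (v : ℝ) ^ (1 / (p - 1))⌉₊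


lemma aux_exists_tail {ι : Type*} (Γ : Finset ι) (y : ι → ℝ) (n : ℕ) :
    ∃ A ⊆ Γ, A.card ≤ n ∧ ∀ A' ⊆ Γ, A'.card ≤ n → ∑ i ∈ Γ \ A, y i ≤ ∑ i ∈ Γ \ A', y i := by
  obtain ⟨A, hA, hm⟩ := Finset.exists_min_image (Γ.powerset.filter fun A => A.card ≤ n)
    (fun A => ∑ i ∈ Γ \ A, y i) ⟨∅, by simp⟩
  simp only [Finset.mem_filter, Finset.mem_powerset] at hA hm
  exact ⟨A, hA.1, hA.2, fun A' h1 h2 => hm A' ⟨h1, h2⟩⟩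

lemma aux_dec (e : ℕ → ℝ) (hmono : ∀ k, e (k + 1) ≤ e k) (θ r : ℝ) (k0 L : ℕ)
    (h : ∀ k, k0 ≤ k → k < k0 + L → θ < e k → e (k + 1) ≤ e k * Real.exp (-r)) :
    e (k0 + L) ≤ θ ∨ e (k0 + L) ≤ e k0 * Real.exp (-(r * L)) := by
  induction L with
  | zero => right; simp
  | succ L ih =>
    rcases ih (fun k h1 h2 h3 => h k h1 (by omega) h3) with h1 | h1
    · left; exact (hmono _).trans h1
    · by_cases h2 : θ < e (k0 + L)
      · right
        have := h (k0 + L) (by omega) (by omega) h2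
        calc e (k0 + (L + 1)) ≤ e (k0 + L) * Real.exp (-r) := this
          _ ≤ e k0 * Real.exp (-(r * L)) * Real.exp (-r) := by gcongr
          _ = e k0 * Real.exp (-(r * ((L + 1 : ℕ) : ℝ))) := by
            rw [mul_assoc, ← Real.exp_add]; congr 2; push_cast; ring
      · left; exact (hmono _).trans (not_lt.mp h2)

/-- sizes `0,1,2,4,...` -/
def auxSz (i : ℕ) : ℕ := match i with
  | 0 => 0
  | (j + 1) => 2 ^ j

lemma aux_greedy_step {ι : Type*} (e : ℕ → ℝ) (he : ∀ k, 0 ≤ e k)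
    (hmono : ∀ k, e (k + 1) ≤ e k)
    (Γ : ℕ → Finset ι) (hΓ : ∀ k, Γ (k + 1) ⊆ Γ k) (y : ι → ℝ) (hy : ∀ i, 0 ≤ y i)
    (ε B V1 δ a D : ℝ) (hε : 0 ≤ ε) (hB : 0 < B) (hV1 : 0 < V1) (hδ : 0 < δ) (ha : 1 ≤ a)
    (hD1 : 1 < D) (hD : 8 * V1 * B < D) (S : ℕ)
    (C1 : ∀ k, k ≤ S → e k ≤ ε + B * ∑ i ∈ Γ k, y i)
    (C2 : ∀ k, k ≤ S → ∑ i ∈ Γ k, y i ≤ V1 * (e k + ε))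
    (C3 : ∀ k, k ≤ S → ∀ A : Finset ι, A ⊆ Γ 0 → ∀ n : ℕ, 1 ≤ n → A.card ≤ n →
      2 * (ε + B * ∑ i ∈ Γ k \ A, y i) < e k → e (k + 1) ≤ e k * Real.exp (-(δ * ((n : ℝ) ^ a)⁻¹)))
    (k0 : ℕ) (hne : (Γ k0).Nonempty)
    (hS : (k0 : ℝ) + 2 * (Real.log D / δ + 1) * 2 ^ a * ((Γ k0).card : ℝ) ^ a ≤ S) :
    e S ≤ 4 * ε ∨ ∃ L q : ℕ, 1 ≤ q ∧ (Γ (k0 + L)).card + q ≤ (Γ k0).card ∧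
      (L : ℝ) ≤ 2 * (Real.log D / δ + 1) * 2 ^ a * (q : ℝ) ^ a := by
  have hanti : ∀ k l, k ≤ l → Γ l ⊆ Γ k := fun k l h =>
    (antitone_nat_of_succ_le (f := Γ) hΓ) h
  have heanti : ∀ k l, k ≤ l → e l ≤ e k := fun k l h =>
    (antitone_nat_of_succ_le (f := e) hmono) h
  choose A hA1 hA2 hA3 using fun i => aux_exists_tail (Γ k0) y (auxSz i)
  set τ : ℕ → ℝ := fun i => ∑ j ∈ Γ k0 \ A i, y j with hτ
  have hτ0 : ∀ i, 0 ≤ τ i := fun i => Finset.sum_nonneg fun j _ => hy j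
  have hzero : ∀ i, (Γ k0).card ≤ auxSz i → τ i = 0 := by
    intro i hi
    have := hA3 i (Γ k0) subset_rfl hi
    simp only [Finset.sdiff_self, Finset.sum_empty] at this
    exact le_antisymm this (hτ0 i)
  have hex : ∃ i, D * τ (i + 1) ≤ τ i := by
    refine ⟨(Γ k0).card, ?_⟩
    rw [hzero ((Γ k0).card + 1) (by simpa [auxSz] using (Nat.lt_two_pow_self).le)]
    simpa using hτ0 _
  set Z := Real.log D / δ with hZ
  have hlog : 0 < Real.log D := Real.log_pos hD1
  have hZ0 : 0 < Z := div_pos hlog hδ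
  obtain ⟨i, hi, hmin⟩ : ∃ i, D * τ (i + 1) ≤ τ i ∧ ∀ j < i, τ j < D * τ (j + 1) :=
    ⟨Nat.find hex, Nat.find_spec hex, fun j hj => not_le.mp (Nat.find_min hex hj)⟩
  have hcard1 : 1 ≤ (Γ k0).card := hne.card_pos
  have h2i : 2 ^ i ≤ 2 * (Γ k0).card := by
    rcases i with _ | i
    · simp; omega
    · by_contra hcon
      have : (Γ k0).card ≤ auxSz (i + 1) := by simp only [auxSz]; rw [pow_succ] at hcon; omega
      have h3 := hmin i (by omega)
      rw [hzero _ this] at h3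
      have := hτ0 i
      linarith
  -- iteration counts
  set ℓ : ℕ → ℕ := fun j => ⌈((2 ^ j : ℕ) : ℝ) ^ a * Z⌉₊ with hℓ
  have hsum : ∀ j, ((∑ j' ∈ Finset.range (j + 1), ℓ j' : ℕ) : ℝ) ≤
      2 * (Z + 1) * ((2 ^ j : ℕ) : ℝ) ^ a := by
    have hb : ∀ j, (ℓ j : ℝ) ≤ (Z + 1) * ((2 ^ j : ℕ) : ℝ) ^ a := by
      intro j
      have h1 : (ℓ j : ℝ) ≤ ((2 ^ j : ℕ) : ℝ) ^ a * Z + 1 :=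
        (Nat.ceil_lt_add_one (by positivity)).le
      have h2 : (1 : ℝ) ≤ ((2 ^ j : ℕ) : ℝ) ^ a :=
        Real.one_le_rpow (by exact_mod_cast Nat.one_le_two_pow) (by linarith)
      nlinarith
    intro j
    induction j with
    | zero => simp only [zero_add, Finset.range_one, Finset.sum_singleton]
              have := hb 0
              have h2 : (0 : ℝ) ≤ ((2 ^ 0 : ℕ) : ℝ) ^ a := by positivity
              nlinarith
    | succ j ih =>
      rw [Finset.sum_range_succ, Nat.cast_add]
      have h1 := hb (j + 1)
      have h2 : 2 * ((2 ^ j : ℕ) : ℝ) ^ a ≤ ((2 ^ (j + 1) : ℕ) : ℝ) ^ a := by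
        have : ((2 ^ (j + 1) : ℕ) : ℝ) = 2 * ((2 ^ j : ℕ) : ℝ) := by push_cast; ring
        rw [this, Real.mul_rpow (by norm_num) (by positivity)]
        have : (2 : ℝ) ≤ 2 ^ a := by
          calc (2 : ℝ) = 2 ^ (1 : ℝ) := by simp
            _ ≤ 2 ^ a := Real.rpow_le_rpow_of_exponent_le (by norm_num) ha
        gcongr
      nlinarith
  have hsum2 : ∀ n : ℕ, 2 ^ i ≤ 2 * n → ((∑ j' ∈ Finset.range (i + 1), ℓ j' : ℕ) : ℝ) ≤
      2 * (Z + 1) * 2 ^ a * (n : ℝ) ^ a := by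
    intro n hn
    refine (hsum i).trans ?_
    rw [mul_assoc _ (2 ^ a : ℝ), ← Real.mul_rpow (by norm_num) (by positivity)]
    have : ((2 ^ i : ℕ) : ℝ) ≤ 2 * (n : ℝ) := by exact_mod_cast hn
    gcongr
  have hhor : k0 + ∑ j' ∈ Finset.range (i + 1), ℓ j' ≤ S := by
    have := hsum2 _ h2i
    have h : ((k0 + ∑ j' ∈ Finset.range (i + 1), ℓ j' : ℕ) : ℝ) ≤ S := by
      push_cast at this ⊢; linarith
    exact_mod_cast h
  -- one phase
  have phase : ∀ j, ∀ k, k0 ≤ k → k + ℓ j ≤ S → ∀ E, 0 ≤ E → e k ≤ D * E →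
      e (k + ℓ j) ≤ 2 * (ε + B * τ (j + 1)) ∨ e (k + ℓ j) ≤ E := by
    intro j k hk hkS E hE hek
    have H : ∀ k', k ≤ k' → k' < k + ℓ j → 2 * (ε + B * τ (j + 1)) < e k' →
        e (k' + 1) ≤ e k' * Real.exp (-(δ * (((2 ^ j : ℕ) : ℝ) ^ a)⁻¹)) := by
      intro k' h1 h2 h3
      refine C3 k' (by omega) (A (j + 1)) ((hA1 _).trans (hanti _ _ (by omega))) (2 ^ j)
        Nat.one_le_two_pow (hA2 (j + 1)) (lt_of_le_of_lt ?_ h3)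
      have : ∑ i ∈ Γ k' \ A (j + 1), y i ≤ τ (j + 1) :=
        Finset.sum_le_sum_of_subset_of_nonneg
          (Finset.sdiff_subset_sdiff (hanti _ _ (by omega)) subset_rfl) (fun j _ _ => hy j)
      gcongr
    rcases aux_dec e hmono (2 * (ε + B * τ (j + 1))) (δ * (((2 ^ j : ℕ) : ℝ) ^ a)⁻¹) k (ℓ j) H
      with h | h
    · exact Or.inl h
    · right
      refine h.trans ?_
      have h1 : Real.exp (-(δ * (((2 ^ j : ℕ) : ℝ) ^ a)⁻¹ * (ℓ j : ℝ))) ≤ D⁻¹ := by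
        rw [← Real.exp_log (show 0 < D⁻¹ by positivity), Real.log_inv]
        apply Real.exp_le_exp.mpr
        apply neg_le_neg
        have h2 : ((2 ^ j : ℕ) : ℝ) ^ a * Z ≤ ℓ j := Nat.le_ceil _
        have h3 : (0 : ℝ) < ((2 ^ j : ℕ) : ℝ) ^ a := by positivity
        calc Real.log D = δ * (((2 ^ j : ℕ) : ℝ) ^ a)⁻¹ * (((2 ^ j : ℕ) : ℝ) ^ a * Z) := by
              rw [hZ]; field_simp
          _ ≤ _ := by gcongr
      calc e k * _ ≤ D * E * D⁻¹ := by
            apply mul_le_mul hek h1 (Real.exp_pos _).le (by positivity)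
        _ = E := by field_simp
  have loop : ∀ j, j ≤ i → e (k0 + ∑ j' ∈ Finset.range j, ℓ j') ≤ 2 * (ε + B * τ j) := by
    intro j
    induction j with
    | zero =>
      intro _
      have h0 : A 0 = ∅ := by
        have := hA2 0
        simpa [auxSz] using this
      have h1 := C1 k0 (by omega)
      have h2 : τ 0 = ∑ i ∈ Γ k0, y i := by simp [hτ, h0]
      have := he k0
      simp only [Finset.range_zero, Finset.sum_empty, add_zero, h2]
      linarith
    | succ j ih =>
      intro hj
      have hle : ∑ j' ∈ Finset.range (j + 1), ℓ j' ≤ ∑ j' ∈ Finset.range (i + 1), ℓ j' :=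
        Finset.sum_le_sum_of_subset (Finset.range_mono (by omega))
      rw [Finset.sum_range_succ] at hle ⊢
      rw [← add_assoc]
      have h1 := ih (by omega)
      have h2 := hmin j (by omega)
      have := hτ0 (j + 1)
      have H : e (k0 + ∑ j' ∈ Finset.range j, ℓ j') ≤ D * (2 * (ε + B * τ (j + 1))) := by
        refine h1.trans ?_
        have : B * τ j ≤ D * (B * τ (j + 1)) := by nlinarith
        nlinarith
      rcases phase j (k0 + ∑ j' ∈ Finset.range j, ℓ j') (by omega) (by omega)
        (2 * (ε + B * τ (j + 1))) (by positivity) H with h | h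
      · exact h
      · exact h
  have hfin : e (k0 + ∑ j' ∈ Finset.range (i + 1), ℓ j') ≤ 2 * ε + 2 * B * τ i / D := by
    have hle := hhor
    rw [Finset.sum_range_succ] at hle ⊢
    rw [← add_assoc]
    have hti := hτ0 i
    have h1D : 0 ≤ B * τ i / D := by positivity
    have H : e (k0 + ∑ j' ∈ Finset.range i, ℓ j') ≤ D * (2 * (ε + B * τ i) / D) := by
      have h6 := loop i le_rfl
      have : D * (2 * (ε + B * τ i) / D) = 2 * (ε + B * τ i) := by
        field_simp
      rw [this]; exact h6
    rcases phase i (k0 + ∑ j' ∈ Finset.range i, ℓ j') (by omega) (by omega)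
      (2 * (ε + B * τ i) / D) (by positivity) H with h | h
    · refine h.trans ?_
      have : τ (i + 1) ≤ τ i / D := by rw [le_div_iff₀ (by linarith)]; linarith
      have : B * τ (i + 1) ≤ B * (τ i / D) := by gcongr
      have h5 : 2 * B * τ i / D = 2 * (B * (τ i / D)) := by ring
      rw [h5]; linarith
    · refine h.trans ?_
      have : 2 * (ε + B * τ i) / D = 2 * (ε / D) + 2 * B * τ i / D := by ring
      rw [this]
      have : ε / D ≤ ε := div_le_self hε hD1.le
      linarith
  set L := ∑ j' ∈ Finset.range (i + 1), ℓ j' with hL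
  by_cases hdone : e (k0 + L) ≤ 4 * ε
  · left; exact (heanti _ _ hhor).trans hdone
  right
  push Not at hdone
  have hti := hτ0 i
  have hD0 : 0 < D := by linarith
  have h7 : e (k0 + L) ≤ 4 * (B * τ i / D) := by
    have h5 : 2 * B * τ i / D = 2 * (B * τ i / D) := by ring
    rw [h5] at hfin; linarith
  have hpos : 0 < τ i := by
    by_contra h
    have : τ i = 0 := le_antisymm (not_lt.mp h) hti
    rw [this] at h7; simp at h7; linarith
  have h8 : ∑ j ∈ Γ (k0 + L), y j < τ i := by
    calc _ ≤ V1 * (e (k0 + L) + ε) := C2 _ hhor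
      _ ≤ V1 * (2 * (4 * (B * τ i / D))) := by gcongr; linarith
      _ = (8 * V1 * B / D) * τ i := by ring
      _ < 1 * τ i := by gcongr; rwa [div_lt_one hD0]
      _ = τ i := one_mul _
  have hsub : Γ (k0 + L) ⊆ Γ k0 := hanti _ _ (by omega)
  refine ⟨L, (Γ k0 \ Γ (k0 + L)).card, ?_, ?_, ?_⟩
  rotate_left
  · rw [Finset.card_sdiff_of_subset hsub]
    have := Finset.card_le_card hsub
    omega
  all_goals
    have hq : auxSz i < (Γ k0 \ Γ (k0 + L)).card := by
      by_contra hcon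
      have := hA3 i (Γ k0 \ Γ (k0 + L)) Finset.sdiff_subset (not_lt.mp hcon)
      rw [Finset.sdiff_sdiff_eq_self hsub] at this
      exact absurd h8 (not_lt.mpr this)
  · apply hsum2
    rcases i with _ | i
    · simp; omega
    · simp only [auxSz] at hq; rw [pow_succ]; omega
  · omega

lemma aux_greedy_comb {ι : Type*} (e : ℕ → ℝ) (he : ∀ k, 0 ≤ e k)
    (hmono : ∀ k, e (k + 1) ≤ e k)
    (Γ : ℕ → Finset ι) (hΓ : ∀ k, Γ (k + 1) ⊆ Γ k) (y : ι → ℝ) (hy : ∀ i, 0 ≤ y i)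
    (ε B V1 δ a D : ℝ) (hε : 0 ≤ ε) (hB : 0 < B) (hV1 : 0 < V1) (hδ : 0 < δ) (ha : 1 ≤ a)
    (hD1 : 1 < D) (hD : 8 * V1 * B < D) (S : ℕ)
    (C1 : ∀ k, k ≤ S → e k ≤ ε + B * ∑ i ∈ Γ k, y i)
    (C2 : ∀ k, k ≤ S → ∑ i ∈ Γ k, y i ≤ V1 * (e k + ε))
    (C3 : ∀ k, k ≤ S → ∀ A : Finset ι, A ⊆ Γ 0 → ∀ n : ℕ, 1 ≤ n → A.card ≤ n →
      2 * (ε + B * ∑ i ∈ Γ k \ A, y i) < e k → e (k + 1) ≤ e k * Real.exp (-(δ * ((n : ℝ) ^ a)⁻¹)))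
    (hS : 2 * (Real.log D / δ + 1) * 2 ^ a * ((Γ 0).card : ℝ) ^ a ≤ S) :
    e S ≤ 4 * ε := by
  have hlog : 0 < Real.log D := Real.log_pos hD1
  have hW : 0 ≤ 2 * (Real.log D / δ + 1) * 2 ^ a := by positivity
  suffices H : ∀ n : ℕ, ∀ k0, (Γ k0).card ≤ n →
      (k0 : ℝ) + 2 * (Real.log D / δ + 1) * 2 ^ a * (n : ℝ) ^ a ≤ S → e S ≤ 4 * ε by
    exact H _ 0 le_rfl (by simpa using hS)
  intro n
  induction n using Nat.strong_induction_on with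
  | _ n ih =>
    intro k0 hk0 hS0
    have hk0S : k0 ≤ S := by
      have : (k0 : ℝ) ≤ S := le_trans (le_add_of_nonneg_right (by positivity)) hS0
      exact_mod_cast this
    rcases (Γ k0).eq_empty_or_nonempty with h0 | hne
    · have h1 := C1 k0 hk0S
      rw [h0] at h1
      simp only [Finset.sum_empty, mul_zero, add_zero] at h1
      have := (antitone_nat_of_succ_le (f := e) hmono) hk0S
      linarith
    · have hc : ((Γ k0).card : ℝ) ^ a ≤ (n : ℝ) ^ a := by
        apply Real.rpow_le_rpow (by positivity) (by exact_mod_cast hk0) (by linarith)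
      rcases aux_greedy_step e he hmono Γ hΓ y hy ε B V1 δ a D hε hB hV1 hδ ha hD1 hD S C1 C2 C3 k0
        hne (le_trans (by gcongr) hS0) with h | ⟨L, q, hq, hcard, hL⟩
      · exact h
      · have hqn : q ≤ n := by omega
        refine ih (n - q) (by omega) (k0 + L) (by omega) ?_
        have hsup : ((n - q : ℕ) : ℝ) ^ a + (q : ℝ) ^ a ≤ (n : ℝ) ^ a := by
          have := Real.add_rpow_le_rpow_add (a := ((n - q : ℕ) : ℝ)) (b := (q : ℝ)) (p := a)
            (by positivity) (by positivity) ha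
          rwa [← Nat.cast_add, Nat.sub_add_cancel hqn] at this
        push_cast
        nlinarith [mul_le_mul_of_nonneg_left hsup hW]

/-- A `p`-smooth seminorm. -/
structure AuxNorm {X : Type*} (p : ℝ) (N : (X → ℂ) → ℝ) : Prop where
  nonneg : ∀ f, 0 ≤ N f
  tri : ∀ f g, N (f + g) ≤ N f + N g
  smul : ∀ (z : ℂ) f, N (z • f) = ‖z‖ * N f
  clark : ∀ f g, N (f + g) ^ p + N (f - g) ^ p ≤ 2 * N f ^ p + 2 * N g ^ p

lemma AuxNorm.sub {X : Type*} {p : ℝ} {N : (X → ℂ) → ℝ} (h : AuxNorm p N) (f g : X → ℂ) :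
    N (f - g) ≤ N f + N g := by
  have h1 := h.tri f ((-1 : ℂ) • g)
  rw [h.smul] at h1
  simpa [sub_eq_add_neg] using h1

lemma AuxNorm.sum {X ι : Type*} {p : ℝ} {N : (X → ℂ) → ℝ} (h : AuxNorm p N) (g : ι → X → ℂ)
    (B : ℝ) (hB : ∀ i, N (g i) ≤ B) (A : Finset ι) (c : ι → ℂ) :
    N (∑ i ∈ A, c i • g i) ≤ B * ∑ i ∈ A, ‖c i‖ := by
  induction A using Finset.induction_on with
  | empty =>
    have := h.smul 0 0
    simp at this
    simp [this]
  | insert i A hi ih =>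
    rw [Finset.sum_insert hi, Finset.sum_insert hi]
    refine (h.tri _ _).trans ?_
    rw [h.smul]
    have := mul_le_mul_of_nonneg_left (hB i) (norm_nonneg (c i))
    linarith

lemma aux_W0 {X : Type*} {p : ℝ} {N : (X → ℂ) → ℝ} (hN : AuxNorm p N) (hp : 1 < p)
    (F : (X → ℂ) →ₗ[ℂ] ℂ) (hF : ∀ h, ‖F h‖ ≤ N h) (f : X → ℂ) (hf : F f = ((N f : ℝ) : ℂ))
    (hpos : 0 < N f) (y : X → ℂ) (w : ℝ) (hw : 0 ≤ w) :
    ∃ z : ℂ, N (f + z • y) ^ p ≤ N f ^ p * (1 + 2 * w ^ p * N y ^ p - w * ‖F y‖) := by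
  obtain ⟨z0, hz0, hz1⟩ : ∃ z0 : ℂ, ‖z0‖ = 1 ∧ z0 * F y = -((‖F y‖ : ℝ) : ℂ) := by
    by_cases h : F y = 0
    · exact ⟨1, by simp, by simp [h]⟩
    · have hn : (‖F y‖ : ℝ) ≠ 0 := norm_ne_zero_iff.mpr h
      refine ⟨-((starRingEnd ℂ) (F y) / ((‖F y‖ : ℝ) : ℂ)), ?_, ?_⟩
      · rw [norm_neg, norm_div, RCLike.norm_conj, Complex.norm_real, norm_norm, div_self hn]
      · have hn' : ((‖F y‖ : ℝ) : ℂ) ≠ 0 := by exact_mod_cast hn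
        have h1 : (starRingEnd ℂ) (F y) * F y = ((‖F y‖ : ℝ) : ℂ) ^ 2 := Complex.conj_mul' _
        rw [neg_mul, div_mul_eq_mul_div, h1]
        field_simp
  refine ⟨((w * N f : ℝ) : ℂ) * z0, ?_⟩
  set z : ℂ := ((w * N f : ℝ) : ℂ) * z0 with hz
  have hnz : ‖z‖ = w * N f := by
    rw [hz, norm_mul, hz0, Complex.norm_real, mul_one, Real.norm_of_nonneg (by positivity)]
  have h1 := hN.clark f (z • y)
  have h2 : N f * (1 + w * ‖F y‖) ≤ N (f - z • y) := by
    refine le_trans ?_ (hF _)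
    have : F (f - z • y) = ((N f * (1 + w * ‖F y‖) : ℝ) : ℂ) := by
      rw [map_sub, map_smul, hf, smul_eq_mul, hz, mul_assoc, hz1]; push_cast; ring
    rw [this, Complex.norm_real]
    exact le_abs_self _
  have h3 : N f ^ p * (1 + w * ‖F y‖) ≤ N (f - z • y) ^ p := by
    refine le_trans ?_ (Real.rpow_le_rpow (by positivity) h2 (by linarith))
    rw [Real.mul_rpow hpos.le (by positivity)]
    have h4 : 0 ≤ w * ‖F y‖ := by positivity
    have := one_add_mul_self_le_rpow_one_add (s := w * ‖F y‖) (by linarith) hp.le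
    gcongr
    nlinarith
  have h5 : N (z • y) ^ p = N f ^ p * (w ^ p * N y ^ p) := by
    rw [hN.smul, hnz, Real.mul_rpow (by positivity) (hN.nonneg _), Real.mul_rpow hw hpos.le]; ring
  rw [h5] at h1
  nlinarith

lemma aux_W1 {X : Type*} {p : ℝ} {N : (X → ℂ) → ℝ} (hN : AuxNorm p N) (hp : 1 < p)
    (F : (X → ℂ) →ₗ[ℂ] ℂ) (hF : ∀ h, ‖F h‖ ≤ N h) (f : X → ℂ) (hf : F f = ((N f : ℝ) : ℂ))
    (hpos : 0 < N f) (y : X → ℂ) (hbest : ∀ z : ℂ, N f ≤ N (f + z • y)) : F y = 0 := by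
  by_contra hne
  have hq : 0 < ‖F y‖ := norm_pos_iff.mpr hne
  have hy : 0 < N y := lt_of_lt_of_le hq (hF y)
  set q := ‖F y‖
  set w : ℝ := (q / (4 * N y ^ p)) ^ (1 / (p - 1)) with hw
  have hw0 : 0 < w := by positivity
  obtain ⟨z, hz⟩ := aux_W0 hN hp F hF f hf hpos y w hw0.le
  have h1 : N f ^ p ≤ N (f + z • y) ^ p := Real.rpow_le_rpow hpos.le (hbest z) (by linarith)
  have h2 : 0 < N f ^ p := by positivity
  have h3 : w ^ p = w * (q / (4 * N y ^ p)) := by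
    have : w ^ (p - 1) = q / (4 * N y ^ p) := by
      rw [hw, ← Real.rpow_mul (by positivity), one_div_mul_cancel (by linarith), Real.rpow_one]
    rw [← this]
    nth_rewrite 2 [← Real.rpow_one w]
    rw [← Real.rpow_add hw0]; congr 1; ring
  have h4 : 2 * w ^ p * N y ^ p = w * q / 2 := by
    have : 0 < N y ^ p := by positivity
    rw [h3]; field_simp; norm_num
  rw [h4] at hz
  have : N f ^ p * (1 + w * q / 2 - w * q) < N f ^ p * 1 := by
    apply mul_lt_mul_of_pos_left _ h2
    have : 0 < w * q := by positivity
    linarith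
  linarith

lemma aux_W2 {X : Type*} {p : ℝ} {N : (X → ℂ) → ℝ} (hN : AuxNorm p N) (hp : 1 < p) (hp2 : p ≤ 2)
    (F : (X → ℂ) →ₗ[ℂ] ℂ) (hF : ∀ h, ‖F h‖ ≤ N h) (f : X → ℂ) (hf : F f = ((N f : ℝ) : ℂ))
    (hpos : 0 < N f) (y : X → ℂ) (B θ : ℝ) (hB : 0 < B) (hy : N y ≤ B) (hθ : 0 < θ)
    (hθF : θ ≤ ‖F y‖) :
    ∃ z : ℂ, N (f + z • y) ≤
      N f * Real.exp (-(θ / 4 * (θ / (4 * B ^ p)) ^ (1 / (p - 1)))) := by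
  set w : ℝ := (θ / (4 * B ^ p)) ^ (1 / (p - 1)) with hw
  have hw0 : 0 < w := by positivity
  obtain ⟨z, hz⟩ := aux_W0 hN hp F hF f hf hpos y w hw0.le
  refine ⟨z, ?_⟩
  have h3 : w ^ p = w * (θ / (4 * B ^ p)) := by
    have : w ^ (p - 1) = θ / (4 * B ^ p) := by
      rw [hw, ← Real.rpow_mul (by positivity), one_div_mul_cancel (by linarith), Real.rpow_one]
    rw [← this]
    nth_rewrite 2 [← Real.rpow_one w]
    rw [← Real.rpow_add hw0]; congr 1; ring
  have h4 : 2 * w ^ p * N y ^ p ≤ w * θ / 2 := by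
    have h5 : N y ^ p ≤ B ^ p := Real.rpow_le_rpow (hN.nonneg _) hy (by linarith)
    have : 0 < B ^ p := by positivity
    calc 2 * w ^ p * N y ^ p ≤ 2 * w ^ p * B ^ p := by gcongr
      _ = w * θ / 2 := by rw [h3]; field_simp; norm_num
  have h6 : N (f + z • y) ^ p ≤ (N f * Real.exp (-(θ / 4 * w))) ^ p := by
    refine hz.trans ?_
    rw [Real.mul_rpow hpos.le (Real.exp_pos _).le]
    gcongr
    rw [← Real.exp_mul]
    have h7 : w * θ ≤ w * ‖F y‖ := by gcongr
    have h8 : 0 ≤ w * θ := by positivity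
    calc 1 + 2 * w ^ p * N y ^ p - w * ‖F y‖ ≤ -(θ / 4 * w) * p + 1 := by nlinarith
      _ ≤ _ := Real.add_one_le_exp _
  exact (Real.rpow_le_rpow_iff (hN.nonneg _) (by positivity) (by linarith)).mp h6

lemma aux_wcga {X ι : Type*} {p : ℝ} {N : (X → ℂ) → ℝ} (hN : AuxNorm p N) (hp : 1 < p)
    (hp2 : p ≤ 2) (t : ℝ) (ht : 0 < t) (g : ι → X → ℂ) (f0 : X → ℂ) (φ : ℕ → ι)
    (G : ℕ → X → ℂ) (hW : IsWCGA g N t f0 φ G) (B : ℝ) (hB : 0 < B) (hgB : ∀ i, N (g i) ≤ B)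
    (v u : ℕ) (V : ℝ) (hv : 0 < v) (hV : 0 < V) (hInc : Incoherent g v (u + v) V (1 / p) N)
    (D : ℝ) (hD1 : 1 < D) (hD : 8 * (V * (v : ℝ) ^ (1 / p)) * B < D) 
    (hS : 2 * (Real.log D / (t / (4 * V) / 4 * (t / (4 * V) / (4 * B ^ p)) ^ (1 / (p - 1))) + 1)
      * 2 ^ (1 / (p - 1)) * (v : ℝ) ^ (1 / (p - 1)) ≤ u)
    (T : Finset ι) (hT : T.card ≤ v) (x : ι → ℂ) :
    N (f0 - G u) ≤ 4 * N (f0 - ∑ i ∈ T, x i • g i) := by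
  obtain ⟨hG0, hstep⟩ := hW
  choose F hF1 hF2 hF3 using fun k => (hstep k).1
  have hGs := fun k => (hstep k).2.1
  have hGb := fun k => (hstep k).2.2
  set h : X → ℂ := ∑ i ∈ T, x i • g i with hh
  set ε := N (f0 - h) with hε
  set C : ℕ → Finset ι := fun k => (Finset.range k).image φ with hC
  set Γ : ℕ → Finset ι := fun k => T \ C k with hΓd
  -- span facts
  have hGs' : ∀ k, ∃ c : ι → ℂ, G k = ∑ i ∈ C k, c i • g i := by
    intro k
    rcases k with _ | k
    · exact ⟨0, by simp [hG0]⟩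
    · have h1 := hGs k
      have h2 : (fun j => g (φ j)) '' Set.Iic k = g '' (C (k + 1) : Set ι) := by
        ext y
        simp only [hC, Set.mem_image, Set.mem_Iic, Finset.coe_image, Finset.coe_range, Set.mem_Iio]
        constructor
        · rintro ⟨j, hj, rfl⟩; exact ⟨φ j, ⟨j, by omega, rfl⟩, rfl⟩
        · rintro ⟨i, ⟨j, hj, rfl⟩, rfl⟩; exact ⟨j, by omega, rfl⟩
      rw [h2, Submodule.mem_span_image_finset_iff_exists_fun] at h1
      obtain ⟨c, hc⟩ := h1
      refine ⟨fun i => if h : i ∈ C (k + 1) then c ⟨i, h⟩ else 0, ?_⟩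
      rw [← hc, Finset.univ_eq_attach, ← Finset.sum_attach (C (k + 1))]
      apply Finset.sum_congr rfl; intro i _; simp
  have hbest : ∀ k (c : ι → ℂ), N (f0 - G k) ≤ N (f0 - ∑ i ∈ C k, c i • g i) := by
    intro k c
    rcases k with _ | k
    · simp [hG0, hC]
    · apply hGb k
      apply Submodule.sum_mem
      intro i hi
      simp only [hC, Finset.mem_image, Finset.mem_range] at hi
      obtain ⟨j, hj, rfl⟩ := hi
      exact Submodule.smul_mem _ _ (Submodule.subset_span ⟨j, by simp; omega, rfl⟩)
  choose c hc using hGs'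
  have hCsub : ∀ k, C k ⊆ C (k + 1) := fun k =>
    Finset.image_subset_image (Finset.range_mono (by omega))
  have hext : ∀ (A A' : Finset ι) (d : ι → ℂ), A ⊆ A' →
      ∑ i ∈ A, d i • g i = ∑ i ∈ A', (if i ∈ A then d i else 0) • g i := by
    intro A A' d hAA
    rw [← Finset.sum_subset hAA]
    · apply Finset.sum_congr rfl; intro i hi; simp [hi]
    · intro i _ hi; simp [hi]
  have hmono : ∀ k, N (f0 - G (k + 1)) ≤ N (f0 - G k) := by
    intro k
    rw [hc k, hext _ _ (c k) (hCsub k)]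
    exact hbest _ _
  -- functional kills chosen elements
  have hkill : ∀ k, 0 < N (f0 - G k) → ∀ i ∈ C k, F k (g i) = 0 := by
    intro k hpos i hi
    apply aux_W1 hN hp (F k) (hF1 k) (f0 - G k) (hF2 k) hpos
    intro z
    have : f0 - G k + z • g i = f0 - ∑ j ∈ C k, (c k j - if j = i then z else 0) • g j := by
      have h1 : ∑ j ∈ C k, (c k j - if j = i then z else 0) • g j = G k - z • g i := by
        simp only [sub_smul, Finset.sum_sub_distrib]
        rw [hc k]
        congr 1
        simp [ite_smul, hi]
      rw [h1]; abel
    rw [this]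
    exact hbest k _
  -- coefficient estimate
  have hcoef : ∀ k, k ≤ u → ∀ A ⊆ Γ k, ∑ i ∈ A, ‖x i‖ ≤
      V * (A.card : ℝ) ^ (1 / p) * (N (f0 - G k) + ε) := by
    intro k hk A hA
    have hAT : A ⊆ T := hA.trans Finset.sdiff_subset
    set d : ι → ℂ := fun i => (if i ∈ T then x i else 0) - (if i ∈ C k then c k i else 0)
    have h1 := hInc A (T ∪ C k) (hAT.trans Finset.subset_union_left)
      ((Finset.card_le_card hAT).trans hT) (by
        have h2 : (C k).card ≤ k := by
          simpa using (Finset.card_image_le (s := Finset.range k) (f := φ))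
        have := Finset.card_union_le T (C k)
        omega) d
    have h2 : (fun y => ∑ i ∈ T ∪ C k, d i * g i y) = h - G k := by
      have : (fun y => ∑ i ∈ T ∪ C k, d i * g i y) = ∑ i ∈ T ∪ C k, d i • g i := by
        ext y; simp
      rw [this, hc k, hh, hext T (T ∪ C k) x Finset.subset_union_left,
        hext (C k) (T ∪ C k) (c k) Finset.subset_union_right, ← Finset.sum_sub_distrib]
      apply Finset.sum_congr rfl; intro i _; simp only [d, sub_smul]
    have h3 : ∑ i ∈ A, ‖d i‖ = ∑ i ∈ A, ‖x i‖ := by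
      apply Finset.sum_congr rfl
      intro i hi
      have h4 := hA hi
      simp only [hΓd, Finset.mem_sdiff] at h4
      simp [d, h4.1, h4.2]
    rw [h2, h3] at h1
    refine h1.trans ?_
    gcongr
    have : h - G k = (f0 - G k) - (f0 - h) := by abel
    rw [this]
    exact hN.sub _ _
  have hε0 : 0 ≤ ε := hN.nonneg _
  refine aux_greedy_comb (fun k => N (f0 - G k)) (fun k => hN.nonneg _) hmono Γ ?_
    (fun i => ‖x i‖) (fun i => norm_nonneg _) ε B (V * (v : ℝ) ^ (1 / p))
    (t / (4 * V) / 4 * (t / (4 * V) / (4 * B ^ p)) ^ (1 / (p - 1))) (1 / (p - 1)) D hε0 hB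
    (by positivity) ?_ ?_ hD1 hD u ?_ ?_ ?_ ?_
  · intro k
    exact Finset.sdiff_subset_sdiff subset_rfl (hCsub k)
  · positivity
  · rw [le_div_iff₀ (by linarith)]; linarith
  · intro k hk
    have h1 := hbest k (fun i => if i ∈ T then x i else 0)
    have h2 : f0 - ∑ i ∈ C k, (if i ∈ T then x i else 0) • g i = (f0 - h) + ∑ i ∈ Γ k, x i • g i := by
      have h3 : ∑ i ∈ C k, (if i ∈ T then x i else 0) • g i = ∑ i ∈ T ∩ C k, x i • g i := by
        simp only [ite_smul, zero_smul]
        rw [← Finset.sum_filter]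
        congr 1; ext i; simp [and_comm]
      have h4 := Finset.sum_inter_add_sum_sdiff T (C k) (fun i => x i • g i)
      rw [h3, hh, ← h4]; simp only [hΓd]; abel
    rw [h2] at h1
    refine h1.trans ((hN.tri _ _).trans ?_)
    have := hN.sum g B hgB (Γ k) x
    linarith
  · intro k hk
    refine (hcoef k hk (Γ k) subset_rfl).trans ?_
    have : ((Γ k).card : ℝ) ≤ v := by
      exact_mod_cast (Finset.card_le_card Finset.sdiff_subset).trans hT
    have := hN.nonneg (f0 - G k)
    gcongr
  · intro k hk A hA n hn hAn hlt
    have hsum0 : 0 ≤ B * ∑ i ∈ Γ k \ A, ‖x i‖ :=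
      mul_nonneg hB.le (Finset.sum_nonneg fun i _ => norm_nonneg _)
    have hpos : 0 < N (f0 - G k) := by linarith
    set M := ‖F k (g (φ k))‖ with hM
    have hMi : ∀ i, ‖F k (g i)‖ ≤ M / t := by
      intro i; rw [le_div_iff₀ ht]; linarith [hF3 k i]
    have hM0 : 0 ≤ M := norm_nonneg _
    -- F (h - G) = F (sum over Γ k)
    have hFG : F k (G k) = 0 := by
      rw [hc k, map_sum]
      apply Finset.sum_eq_zero
      intro i hi
      rw [map_smul, hkill k hpos i hi, smul_zero]
    have hFh : F k h = F k (∑ i ∈ Γ k \ A, x i • g i) + ∑ i ∈ Γ k ∩ A, x i * F k (g i) := by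
      have h4 := Finset.sum_inter_add_sum_sdiff T (C k) (fun i => x i • g i)
      have h5 := Finset.sum_inter_add_sum_sdiff (Γ k) A (fun i => x i • g i)
      rw [hh, ← h4, map_add]
      have h6 : F k (∑ i ∈ T ∩ C k, x i • g i) = 0 := by
        rw [map_sum]
        apply Finset.sum_eq_zero
        intro i hi
        rw [map_smul, hkill k hpos i (Finset.mem_inter.mp hi).2, smul_zero]
      rw [h6, zero_add]
      change F k (∑ i ∈ Γ k, x i • g i) = _
      rw [← h5, map_add, add_comm]
      congr 1
      rw [map_sum]; simp
    have hmain : N (f0 - G k) ≤ ε + B * ∑ i ∈ Γ k \ A, ‖x i‖ +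
        M / t * (V * (n : ℝ) ^ (1 / p) * (N (f0 - G k) + ε)) := by
      have h1 : ((N (f0 - G k) : ℝ) : ℂ) = F k (f0 - h) + (F k (∑ i ∈ Γ k \ A, x i • g i) +
          ∑ i ∈ Γ k ∩ A, x i * F k (g i)) := by
        rw [← hFh, ← hF2 k, map_sub, map_sub, hFG]; ring
      have h2 : N (f0 - G k) = ‖((N (f0 - G k) : ℝ) : ℂ)‖ := by
        rw [Complex.norm_real, Real.norm_of_nonneg hpos.le]
      rw [h1] at h2
      have h3 : ‖∑ i ∈ Γ k ∩ A, x i * F k (g i)‖ ≤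
          M / t * (V * (n : ℝ) ^ (1 / p) * (N (f0 - G k) + ε)) := by
        calc ‖∑ i ∈ Γ k ∩ A, x i * F k (g i)‖ ≤ ∑ i ∈ Γ k ∩ A, ‖x i * F k (g i)‖ :=
              norm_sum_le _ _
          _ ≤ ∑ i ∈ Γ k ∩ A, M / t * ‖x i‖ := by
              apply Finset.sum_le_sum; intro i _
              rw [norm_mul, mul_comm]
              exact mul_le_mul_of_nonneg_right (hMi i) (norm_nonneg _)
          _ = M / t * ∑ i ∈ Γ k ∩ A, ‖x i‖ := by rw [Finset.mul_sum]
          _ ≤ _ := by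
              apply mul_le_mul_of_nonneg_left _ (by positivity)
              refine (hcoef k hk (Γ k ∩ A) Finset.inter_subset_left).trans ?_
              have : ((Γ k ∩ A).card : ℝ) ≤ n := by
                exact_mod_cast (Finset.card_le_card Finset.inter_subset_right).trans hAn
              gcongr
      have h4 := (hF1 k (∑ i ∈ Γ k \ A, x i • g i)).trans (hN.sum g B hgB (Γ k \ A) x)
      have h5 := hF1 k (f0 - h)
      have h6 := norm_add_le (F k (f0 - h)) (F k (∑ i ∈ Γ k \ A, x i • g i) +
          ∑ i ∈ Γ k ∩ A, x i * F k (g i))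
      have h7 := norm_add_le (F k (∑ i ∈ Γ k \ A, x i • g i)) (∑ i ∈ Γ k ∩ A, x i * F k (g i))
      linarith
    have hn0 : (0 : ℝ) < n := by exact_mod_cast hn
    have hnp : 0 < (n : ℝ) ^ (1 / p) := by positivity
    have hθ : t / (4 * V) / (n : ℝ) ^ (1 / p) ≤ M := by
      have h1 : N (f0 - G k) + ε ≤ 2 * N (f0 - G k) := by linarith
      have h2 : M / t * (V * (n : ℝ) ^ (1 / p) * (N (f0 - G k) + ε)) ≤
          M / t * (V * (n : ℝ) ^ (1 / p) * (2 * N (f0 - G k))) := by gcongr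
      have h3 : N (f0 - G k) * (1 / 2) ≤
          N (f0 - G k) * (M / t * (V * (n : ℝ) ^ (1 / p) * 2)) := by nlinarith
      have h4 := le_of_mul_le_mul_left h3 hpos
      rw [div_div, div_le_iff₀ (by positivity)]
      rw [div_mul_eq_mul_div, le_div_iff₀ ht] at h4
      linarith
    obtain ⟨z, hz⟩ := aux_W2 hN hp hp2 (F k) (hF1 k) (f0 - G k) (hF2 k) hpos (g (φ k)) B
      (t / (4 * V) / (n : ℝ) ^ (1 / p)) hB (hgB _) (by positivity) hθ
    have hnext : N (f0 - G (k + 1)) ≤ N (f0 - G k + z • g (φ k)) := by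
      have h1 : f0 - G k + z • g (φ k) = f0 - (G k - z • g (φ k)) := by abel
      rw [h1]
      apply hGb k
      apply Submodule.sub_mem
      · rw [hc k]
        apply Submodule.sum_mem
        intro i hi
        simp only [hC, Finset.mem_image, Finset.mem_range] at hi
        obtain ⟨j, hj, rfl⟩ := hi
        exact Submodule.smul_mem _ _ (Submodule.subset_span ⟨j, by simp; omega, rfl⟩)
      · exact Submodule.smul_mem _ _ (Submodule.subset_span ⟨k, by simp, rfl⟩)
    refine hnext.trans (hz.trans (le_of_eq ?_))
    congr 3
    have hq : 0 < t / (4 * V) := by positivity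
    set q := t / (4 * V)
    have e1 : q / (n : ℝ) ^ (1 / p) / (4 * B ^ p) = q / (4 * B ^ p) * ((n : ℝ) ^ (1 / p))⁻¹ := by
      field_simp
    rw [e1, Real.mul_rpow (by positivity) (by positivity), Real.inv_rpow (by positivity),
      ← Real.rpow_mul hn0.le]
    have e2 : (n : ℝ) ^ (1 / (p - 1)) = (n : ℝ) ^ (1 / p) * (n : ℝ) ^ (1 / p * (1 / (p - 1))) := by
      rw [← Real.rpow_add hn0]; congr 1
      have : p - 1 ≠ 0 := by linarith
      field_simp
      ring
    rw [e2, mul_inv]; ring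
  · refine le_trans ?_ hS
    have : ((Γ 0).card : ℝ) ≤ v := by
      exact_mod_cast (Finset.card_le_card Finset.sdiff_subset).trans hT
    have hlog : 0 < Real.log D := Real.log_pos hD1
    gcongr

lemma aux_clark_pt (p : ℝ) (hp : 0 < p) (hp2 : p ≤ 2) (a b : ℂ) :
    ‖a + b‖ ^ p + ‖a - b‖ ^ p ≤ 2 * ‖a‖ ^ p + 2 * ‖b‖ ^ p := by
  have key : ∀ x : ℝ, 0 ≤ x → x ^ p = (x ^ 2) ^ (p / 2) := by
    intro x hx
    rw [← Real.rpow_natCast, ← Real.rpow_mul hx]; congr 1; push_cast; ring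
  have hpar : ‖a + b‖ ^ 2 + ‖a - b‖ ^ 2 = 2 * ‖a‖ ^ 2 + 2 * ‖b‖ ^ 2 := by
    have := parallelogram_law_with_norm ℝ a b
    nlinarith
  rw [key _ (norm_nonneg (a + b)), key _ (norm_nonneg (a - b)), key _ (norm_nonneg a),
    key _ (norm_nonneg b)]
  have hc := (Real.concaveOn_rpow (p := p / 2) (by linarith) (by linarith)).2
    (show ‖a + b‖ ^ 2 ∈ Set.Ici (0 : ℝ) by simp)
    (show ‖a - b‖ ^ 2 ∈ Set.Ici (0 : ℝ) by simp)
    (show (0 : ℝ) ≤ 1 / 2 by norm_num) (show (0 : ℝ) ≤ 1 / 2 by norm_num) (by norm_num)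
  simp only [smul_eq_mul] at hc
  have h2 := Real.rpow_add_le_add_rpow (p := p / 2) (sq_nonneg ‖a‖) (sq_nonneg ‖b‖)
    (by linarith) (by linarith)
  have h3 : 1 / 2 * ‖a + b‖ ^ 2 + 1 / 2 * ‖a - b‖ ^ 2 = ‖a‖ ^ 2 + ‖b‖ ^ 2 := by linarith
  rw [h3] at hc
  linarith

lemma dNorm_rpow {X : Type*} {m : ℕ} (ξ : Fin m → X) (p : ℝ) (hp : 0 < p) (f : X → ℂ) :
    dNorm ξ p f ^ p = (m : ℝ)⁻¹ * ∑ j, ‖f (ξ j)‖ ^ p := by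
  unfold dNorm
  have h0 : 0 ≤ (m : ℝ)⁻¹ * ∑ j, ‖f (ξ j)‖ ^ p := by positivity
  rw [← Real.rpow_mul h0, one_div_mul_cancel hp.ne', Real.rpow_one]

lemma aux_dNorm {X : Type*} {m : ℕ} (ξ : Fin m → X) (p : ℝ) (hp : 1 < p) (hp2 : p ≤ 2) :
    AuxNorm p (dNorm ξ p) := by
  refine ⟨fun f => by unfold dNorm; positivity, ?_, ?_, ?_⟩
  · intro f g
    unfold dNorm
    rw [Real.mul_rpow (by positivity) (by positivity), Real.mul_rpow (by positivity) (by positivity),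
      Real.mul_rpow (by positivity) (by positivity), ← mul_add]
    apply mul_le_mul_of_nonneg_left _ (by positivity)
    have h := Real.Lp_add_le Finset.univ (fun j => ‖f (ξ j)‖) (fun j => ‖g (ξ j)‖) hp.le
    simp only [abs_norm] at h
    refine le_trans ?_ h
    apply Real.rpow_le_rpow (by positivity) _ (by positivity)
    apply Finset.sum_le_sum
    intro j _
    apply Real.rpow_le_rpow (by positivity) _ (by linarith)
    rw [abs_of_nonneg (by positivity)]
    exact norm_add_le _ _
  · intro z f
    unfold dNorm
    have : ∀ j, ‖(z • f) (ξ j)‖ ^ p = ‖z‖ ^ p * ‖f (ξ j)‖ ^ p := by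
      intro j
      rw [Pi.smul_apply, smul_eq_mul, norm_mul, Real.mul_rpow (by positivity) (by positivity)]
    simp only [this]
    rw [← Finset.mul_sum, mul_left_comm, Real.mul_rpow (by positivity) (by positivity),
      ← Real.rpow_mul (by positivity), mul_one_div_cancel (by linarith), Real.rpow_one]
  · intro f g
    simp only [dNorm_rpow ξ p (by linarith)]
    have : ∑ j, ‖(f + g) (ξ j)‖ ^ p + ∑ j, ‖(f - g) (ξ j)‖ ^ p ≤
        2 * ∑ j, ‖f (ξ j)‖ ^ p + 2 * ∑ j, ‖g (ξ j)‖ ^ p := by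
      rw [Finset.mul_sum, Finset.mul_sum, ← Finset.sum_add_distrib, ← Finset.sum_add_distrib]
      exact Finset.sum_le_sum fun j _ => aux_clark_pt p (by linarith) hp2 _ _
    have h2 := mul_le_mul_of_nonneg_left this (show 0 ≤ (m : ℝ)⁻¹ by positivity)
    linarith

lemma aux_dNorm_le {X : Type*} {m : ℕ} (ξ : Fin m → X) (p : ℝ) (hp : 1 < p) (f : X → ℂ)
    (B : ℝ) (hB : 0 ≤ B) (hf : ∀ x, ‖f x‖ ≤ B) : dNorm ξ p f ≤ B := by
  have h0 : (m : ℝ)⁻¹ * ∑ j, ‖f (ξ j)‖ ^ p ≤ B ^ p := by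
    have h1 : ∑ j, ‖f (ξ j)‖ ^ p ≤ ∑ j : Fin m, B ^ p :=
      Finset.sum_le_sum fun j _ => Real.rpow_le_rpow (norm_nonneg _) (hf _) (by linarith)
    rw [Finset.sum_const, Finset.card_univ, Fintype.card_fin, nsmul_eq_mul] at h1
    rcases Nat.eq_zero_or_pos m with rfl | hm
    · simp; positivity
    · have hm' : (0 : ℝ) < m := by exact_mod_cast hm
      rw [inv_mul_le_iff₀ hm']; exact h1
  unfold dNorm
  calc _ ≤ (B ^ p) ^ (1 / p) := Real.rpow_le_rpow (by positivity) h0 (by positivity)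
    _ = B := by rw [← Real.rpow_mul hB, mul_one_div_cancel (by linarith), Real.rpow_one]

/-- Derandomised selection (lower Chernoff bound by a potential function). -/
lemma aux_select {X ι : Type*} [Fintype ι] (φ : ι → X → ℝ) (b A L : ι → ℝ)
    (hb : ∀ i, 0 < b i) (h0 : ∀ i x, 0 ≤ φ i x) (h1 : ∀ i x, φ i x ≤ b i)
    (hex : ∀ a : ι → ℝ, (∀ i, 0 ≤ a i) → ∃ x, ∑ i, a i * A i ≤ ∑ i, a i * φ i x)
    (hL : ∑ i, Real.exp (-L i) ≤ 1) (m : ℕ) :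
    ∃ ξ : Fin m → X, ∀ i, m * (A i / 2) - b i * L i ≤ ∑ j, φ i (ξ j) := by
  have key : ∀ m : ℕ, ∃ ξ : Fin m → X,
      ∑ i, Real.exp (-L i + (m * (A i / 2) - ∑ j, φ i (ξ j)) / b i) ≤ 1 := by
    intro m
    induction m with
    | zero => exact ⟨Fin.elim0, by simpa using hL⟩
    | succ m ih =>
      obtain ⟨ξ, hξ⟩ := ih
      set W : ι → ℝ := fun i => Real.exp (-L i + (m * (A i / 2) - ∑ j, φ i (ξ j)) / b i) with hW
      set a : ι → ℝ := fun i => W i * Real.exp (A i / 2 / b i) / (2 * b i) with ha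
      have hW0 : ∀ i, 0 < W i := fun i => Real.exp_pos _
      obtain ⟨x, hx⟩ := hex a (fun i => by
        have := hb i; have := hW0 i; simp only [ha]; positivity)
      refine ⟨Fin.cons x ξ, le_trans ?_ hξ⟩
      have e1 : ∀ i, Real.exp (-L i + (((m + 1 : ℕ) : ℝ) * (A i / 2) -
          ∑ j, φ i ((Fin.cons x ξ : Fin (m + 1) → X) j)) / b i) ≤
          W i * Real.exp (A i / 2 / b i) - a i * φ i x := by
        intro i
        have hbi := hb i
        have : -L i + (((m + 1 : ℕ) : ℝ) * (A i / 2) -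
            ∑ j, φ i ((Fin.cons x ξ : Fin (m + 1) → X) j)) / b i =
            (-L i + (m * (A i / 2) - ∑ j, φ i (ξ j)) / b i) + A i / 2 / b i + -(φ i x / b i) := by
          rw [Fin.sum_univ_succ]
          simp only [Fin.cons_zero, Fin.cons_succ]
          push_cast
          field_simp
          ring
        rw [this, Real.exp_add, Real.exp_add]
        have h2 : Real.exp (-(φ i x / b i)) ≤ 1 - φ i x / b i / 2 := by
          have hy0 : 0 ≤ φ i x / b i := div_nonneg (h0 i x) hbi.le
          have hy1 : φ i x / b i ≤ 1 := (div_le_one hbi).mpr (h1 i x)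
          set y := φ i x / b i
          have h3 := Real.add_one_le_exp y
          rw [Real.exp_neg, inv_le_comm₀ (Real.exp_pos _) (by linarith)]
          refine le_trans ?_ h3
          rw [inv_le_iff_one_le_mul₀ (by linarith)]
          nlinarith
        have h4 : 0 < W i * Real.exp (A i / 2 / b i) := mul_pos (hW0 i) (Real.exp_pos _)
        calc _ ≤ W i * Real.exp (A i / 2 / b i) * (1 - φ i x / b i / 2) :=
              mul_le_mul_of_nonneg_left h2 h4.le
          _ = _ := by simp only [ha]; field_simp
      refine (Finset.sum_le_sum fun i _ => e1 i).trans ?_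
      rw [Finset.sum_sub_distrib]
      have e2 : ∀ i, W i * Real.exp (A i / 2 / b i) - a i * A i ≤ W i := by
        intro i
        have hbi := hb i
        have h3 := Real.add_one_le_exp (-(A i / 2 / b i))
        have h4 : 0 < W i * Real.exp (A i / 2 / b i) := mul_pos (hW0 i) (Real.exp_pos _)
        have h5 := mul_le_mul_of_nonneg_left h3 h4.le
        have h6 : W i * Real.exp (A i / 2 / b i) * Real.exp (-(A i / 2 / b i)) = W i := by
          rw [mul_assoc, ← Real.exp_add, add_neg_cancel, Real.exp_zero, mul_one]
        rw [h6] at h5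
        refine le_trans (le_of_eq ?_) h5
        simp only [ha]; field_simp; ring
      have e3 := Finset.sum_le_sum fun i (_ : i ∈ Finset.univ) => e2 i
      rw [Finset.sum_sub_distrib] at e3
      linarith
  obtain ⟨ξ, hξ⟩ := key m
  refine ⟨ξ, fun i => ?_⟩
  have h2 := (Finset.single_le_sum (f := fun i => Real.exp (-L i + (m * (A i / 2) -
    ∑ j, φ i (ξ j)) / b i)) (fun i _ => (Real.exp_pos _).le) (Finset.mem_univ i)).trans hξ
  simp only [Real.exp_le_one_iff] at h2
  have hbi := hb i
  have h3 : (m * (A i / 2) - ∑ j, φ i (ξ j)) / b i ≤ L i := by linarith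
  rw [div_le_iff₀ hbi] at h3
  linarith

/-- Derandomised Maurey lemma. -/
lemma aux_maurey {ι Y : Type*} [Fintype ι] [Fintype Y] [Nonempty Y] (w : ι → ℝ)
    (hw : ∀ d, 0 ≤ w d) (hw1 : ∑ d, w d = 1) (z : ι → Y → ℝ) (ρ ε : ℝ) (hρ : 0 < ρ)
    (hε : 0 < ε) (hερ : ε ≤ ρ) (hz : ∀ d y, |z d y| ≤ ρ) (n : ℕ)
    (hn : 16 * ρ ^ 2 * Real.log (Fintype.card Y) ≤ n * ε ^ 2) :
    ∃ D : Fin n → ι, ∀ y, ∑ j, z (D j) y - n * ∑ d, w d * z d y ≤ n * ε := by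
  set zb : Y → ℝ := fun y => ∑ d, w d * z d y with hzb
  set τ : ℝ := ε / (8 * ρ ^ 2) with hτ
  have hτ0 : 0 < τ := by positivity
  have hzb1 : ∀ y, |zb y| ≤ ρ := by
    intro y
    calc |zb y| ≤ ∑ d, |w d * z d y| := Finset.abs_sum_le_sum_abs _ _
      _ ≤ ∑ d, w d * ρ := by
          apply Finset.sum_le_sum; intro d _
          rw [abs_mul, abs_of_nonneg (hw d)]
          exact mul_le_mul_of_nonneg_left (hz d y) (hw d)
      _ = ρ := by rw [← Finset.sum_mul, hw1, one_mul]
  have key : ∀ n : ℕ, ∃ D : Fin n → ι,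
      ∑ y, Real.exp (τ * (∑ j, z (D j) y - n * zb y)) ≤
        Fintype.card Y * Real.exp (n * (4 * τ ^ 2 * ρ ^ 2)) := by
    intro n
    induction n with
    | zero => exact ⟨Fin.elim0, by simp⟩
    | succ n ih =>
      obtain ⟨D, hD⟩ := ih
      set W : Y → ℝ := fun y => Real.exp (τ * (∑ j, z (D j) y - n * zb y)) with hW
      have hW0 : ∀ y, 0 < W y := fun y => Real.exp_pos _
      have hex : ∃ d, ∑ y, W y * (z d y - zb y) ≤ 0 := by
        by_contra hcon
        push Not at hcon
        have h1 : ∑ d, w d * ∑ y, W y * (z d y - zb y) = 0 := by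
          simp only [Finset.mul_sum]
          rw [Finset.sum_comm]
          apply Finset.sum_eq_zero
          intro y _
          have : ∀ d, w d * (W y * (z d y - zb y)) = W y * (w d * z d y) - W y * (w d * zb y) := by
            intro d; ring
          simp only [this]
          rw [Finset.sum_sub_distrib, ← Finset.mul_sum, ← Finset.mul_sum, ← Finset.sum_mul, hw1,
            one_mul, sub_self]
        have h2 : 0 < ∑ d, w d * ∑ y, W y * (z d y - zb y) := by
          obtain ⟨d, -, hd⟩ : ∃ d ∈ Finset.univ, 0 < w d := by
            by_contra hc
            push Not at hc
            have : ∑ d, w d ≤ 0 := Finset.sum_nonpos hc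
            linarith
          exact Finset.sum_pos' (fun d _ => mul_nonneg (hw d) (hcon d).le)
            ⟨d, Finset.mem_univ d, mul_pos hd (hcon d)⟩
        linarith
      obtain ⟨d, hd⟩ := hex
      refine ⟨Fin.cons d D, ?_⟩
      have e1 : ∀ y, Real.exp (τ * (∑ j, z ((Fin.cons d D : Fin (n + 1) → ι) j) y -
          ((n + 1 : ℕ) : ℝ) * zb y)) ≤ W y * (1 + 4 * τ ^ 2 * ρ ^ 2) +
            τ * (W y * (z d y - zb y)) := by
        intro y
        have : τ * (∑ j, z ((Fin.cons d D : Fin (n + 1) → ι) j) y - ((n + 1 : ℕ) : ℝ) * zb y) =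
            τ * (∑ j, z (D j) y - n * zb y) + τ * (z d y - zb y) := by
          rw [Fin.sum_univ_succ]
          simp only [Fin.cons_zero, Fin.cons_succ]
          push_cast; ring
        rw [this, Real.exp_add]
        have hab : |z d y - zb y| ≤ 2 * ρ := by
          have := abs_sub (z d y) (zb y)
          linarith [hz d y, hzb1 y]
        have hx : |τ * (z d y - zb y)| ≤ 1 := by
          rw [abs_mul, abs_of_pos hτ0]
          calc τ * |z d y - zb y| ≤ τ * (2 * ρ) := by gcongr
            _ = ε / ρ / 4 := by rw [hτ]; field_simp; norm_num
            _ ≤ 1 := by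
              have : ε / ρ ≤ 1 := (div_le_one hρ).mpr hερ
              linarith
        have h2 := Real.abs_exp_sub_one_sub_id_le hx
        have h3 := (abs_le.mp h2).2
        have h4 : (τ * (z d y - zb y)) ^ 2 ≤ 4 * τ ^ 2 * ρ ^ 2 := by
          have : (z d y - zb y) ^ 2 ≤ (2 * ρ) ^ 2 := by
            rw [← sq_abs]; gcongr
          nlinarith [sq_nonneg τ]
        have h5 : Real.exp (τ * (z d y - zb y)) ≤ 1 + 4 * τ ^ 2 * ρ ^ 2 + τ * (z d y - zb y) := by
          linarith
        have := mul_le_mul_of_nonneg_left h5 (hW0 y).le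
        refine this.trans (le_of_eq ?_)
        ring
      refine (Finset.sum_le_sum fun y _ => e1 y).trans ?_
      rw [Finset.sum_add_distrib, ← Finset.sum_mul, ← Finset.mul_sum]
      have e2 : τ * ∑ y, W y * (z d y - zb y) ≤ 0 := mul_nonpos_of_nonneg_of_nonpos hτ0.le hd
      have e3 : 1 + 4 * τ ^ 2 * ρ ^ 2 ≤ Real.exp (4 * τ ^ 2 * ρ ^ 2) := by
        have := Real.add_one_le_exp (4 * τ ^ 2 * ρ ^ 2); linarith
      have e4 : (∑ y, W y) * (1 + 4 * τ ^ 2 * ρ ^ 2) ≤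
          (Fintype.card Y * Real.exp (n * (4 * τ ^ 2 * ρ ^ 2))) * Real.exp (4 * τ ^ 2 * ρ ^ 2) := by
        gcongr
      have e5 : (Fintype.card Y * Real.exp (n * (4 * τ ^ 2 * ρ ^ 2))) * Real.exp (4 * τ ^ 2 * ρ ^ 2)
          = Fintype.card Y * Real.exp (((n + 1 : ℕ) : ℝ) * (4 * τ ^ 2 * ρ ^ 2)) := by
        rw [mul_assoc, ← Real.exp_add]; congr 2; push_cast; ring
      linarith
  obtain ⟨D, hD⟩ := key n
  refine ⟨D, fun y => ?_⟩
  have h2 := (Finset.single_le_sum (f := fun y => Real.exp (τ * (∑ j, z (D j) y - n * zb y)))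
    (fun i _ => (Real.exp_pos _).le) (Finset.mem_univ y)).trans hD
  have hY : (0 : ℝ) < Fintype.card Y := by exact_mod_cast Fintype.card_pos
  have h3 : (Fintype.card Y : ℝ) * Real.exp (n * (4 * τ ^ 2 * ρ ^ 2)) =
      Real.exp (Real.log (Fintype.card Y) + n * (4 * τ ^ 2 * ρ ^ 2)) := by
    rw [Real.exp_add, Real.exp_log hY]
  rw [h3] at h2
  have h4 := Real.exp_le_exp.mp h2
  have h5 : Real.log (Fintype.card Y) ≤ n * ε ^ 2 / (16 * ρ ^ 2) := by
    rw [le_div_iff₀ (by positivity)]; linarith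
  have h6 : n * ε ^ 2 / (16 * ρ ^ 2) + n * (4 * τ ^ 2 * ρ ^ 2) = τ * (n * ε) := by
    rw [hτ]; field_simp; ring
  exact le_of_mul_le_mul_left (by linarith) hτ0

/-- Bounded orthonormal systems. -/
structure AuxONS {X : Type*} [MeasurableSpace X] (μ : Measure X) {N : ℕ} (g : Fin N → X → ℂ)
    (B : ℝ) : Prop where
  meas : ∀ i, Measurable (g i)
  one_le : 1 ≤ B
  bdd : ∀ i x, ‖g i x‖ ≤ B
  orth : ∀ i j, ∫ x, g i x * (starRingEnd ℂ) (g j x) ∂μ = if i = j then 1 else 0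

/-- Linear combination. -/
def auxF {X : Type*} {N : ℕ} (g : Fin N → X → ℂ) (S : Finset (Fin N)) (c : Fin N → ℂ) : X → ℂ :=
  fun x => ∑ i ∈ S, c i * g i x

lemma AuxONS.measF {X : Type*} [MeasurableSpace X] {μ : Measure X} {N : ℕ} {g : Fin N → X → ℂ}
    {B : ℝ} (h : AuxONS μ g B) (S : Finset (Fin N)) (c : Fin N → ℂ) : Measurable (auxF g S c) := by
  unfold auxF
  exact Finset.measurable_fun_sum _ fun i _ => (h.meas i).const_mul _

lemma auxF_bdd {X : Type*} {N : ℕ} {g : Fin N → X → ℂ}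
    {B : ℝ} (h : ∀ i x, ‖g i x‖ ≤ B) (S : Finset (Fin N)) (c : Fin N → ℂ) (x : X) :
    ‖auxF g S c x‖ ≤ B * ∑ i ∈ S, ‖c i‖ := by
  unfold auxF
  rw [Finset.mul_sum]
  refine (norm_sum_le _ _).trans (Finset.sum_le_sum fun i _ => ?_)
  rw [norm_mul, mul_comm]
  exact mul_le_mul_of_nonneg_right (h i x) (norm_nonneg _)

lemma AuxONS.orthF {X : Type*} [MeasurableSpace X] {μ : Measure X} [IsProbabilityMeasure μ] {N : ℕ}
    {g : Fin N → X → ℂ} {B : ℝ} (h : AuxONS μ g B) (S A : Finset (Fin N)) (hA : A ⊆ S)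
    (c s : Fin N → ℂ) :
    ∫ x, auxF g S c x * (starRingEnd ℂ) (auxF g A s x) ∂μ =
      ∑ i ∈ A, c i * (starRingEnd ℂ) (s i) := by
  have e : ∀ x, auxF g S c x * (starRingEnd ℂ) (auxF g A s x) = ∑ i ∈ S, ∑ j ∈ A,
      c i * (starRingEnd ℂ) (s j) * (g i x * (starRingEnd ℂ) (g j x)) := by
    intro x
    unfold auxF
    rw [map_sum, Finset.sum_mul_sum]
    refine Finset.sum_congr rfl fun i _ => Finset.sum_congr rfl fun j _ => ?_
    rw [map_mul]; ring
  have hint : ∀ i j, Integrable (fun x => g i x * (starRingEnd ℂ) (g j x)) μ := by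
    intro i j
    apply Integrable.of_bound (C := B * B)
    · apply Measurable.aestronglyMeasurable
      exact (h.meas i).mul (Complex.continuous_conj.measurable.comp (h.meas j))
    · refine Filter.Eventually.of_forall fun x => ?_
      rw [norm_mul, RCLike.norm_conj]
      have := h.one_le
      exact mul_le_mul (h.bdd i x) (h.bdd j x) (norm_nonneg _) (by linarith)
  simp only [e]
  rw [MeasureTheory.integral_finsetSum]
  swap
  · intro i _
    exact MeasureTheory.integrable_finsetSum _ fun j _ => (hint i j).const_mul _
  have e2 : ∀ i ∈ S, ∫ x, ∑ j ∈ A, c i * (starRingEnd ℂ) (s j) * (g i x * (starRingEnd ℂ) (g j x)) ∂μ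
      = ∑ j ∈ A, if i = j then c i * (starRingEnd ℂ) (s j) else 0 := by
    intro i _
    rw [MeasureTheory.integral_finsetSum _ fun j _ => (hint i j).const_mul _]
    refine Finset.sum_congr rfl fun j _ => ?_
    rw [MeasureTheory.integral_const_mul, h.orth]
    split_ifs <;> simp
  rw [Finset.sum_congr rfl e2, Finset.sum_comm]
  refine Finset.sum_congr rfl fun j hj => ?_
  rw [Finset.sum_ite_eq' S j]
  simp [hA hj]

lemma AuxONS.intF {X : Type*} [MeasurableSpace X] {μ : Measure X} [IsProbabilityMeasure μ] {N : ℕ}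
    {g : Fin N → X → ℂ} {B : ℝ} (h : AuxONS μ g B) (S : Finset (Fin N))
    (c : Fin N → ℂ) (q : ℝ) (hq : 0 ≤ q) : Integrable (fun x => ‖auxF g S c x‖ ^ q) μ := by
  apply Integrable.of_bound (C := (B * ∑ i ∈ S, ‖c i‖) ^ q)
  · exact ((h.measF S c).norm.pow_const q).aestronglyMeasurable
  · refine Filter.Eventually.of_forall fun x => ?_
    rw [Real.norm_of_nonneg (by positivity)]
    exact Real.rpow_le_rpow (norm_nonneg _) (auxF_bdd h.bdd S c x) hq

lemma AuxONS.inc {X : Type*} [MeasurableSpace X] {μ : Measure X} [IsProbabilityMeasure μ] {N : ℕ}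
    {g : Fin N → X → ℂ} {B : ℝ} (h : AuxONS μ g B) (q : ℝ) (hq : 1 < q) (hq2 : q ≤ 2)
    (S A : Finset (Fin N)) (hA : A ⊆ S) (c : Fin N → ℂ) :
    ∑ i ∈ A, ‖c i‖ ≤ B * (A.card : ℝ) ^ (1 / q) * (∫ x, ‖auxF g S c x‖ ^ q ∂μ) ^ (1 / q) := by
  rcases A.eq_empty_or_nonempty with rfl | hne
  · simp only [Finset.sum_empty]
    have := h.one_le
    positivity
  have hcard : (0 : ℝ) < A.card := by exact_mod_cast hne.card_pos
  have hB := h.one_le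
  set s : Fin N → ℂ := fun i => c i / ((‖c i‖ : ℝ) : ℂ) with hs
  have hs1 : ∀ i, ‖s i‖ ≤ 1 := by
    intro i
    simp only [hs]
    rw [norm_div, Complex.norm_real, norm_norm]
    exact div_self_le_one _
  have hs2 : ∀ i, c i * (starRingEnd ℂ) (s i) = ((‖c i‖ : ℝ) : ℂ) := by
    intro i
    simp only [hs]
    by_cases hc : c i = 0
    · simp [hc]
    have hn : ((‖c i‖ : ℝ) : ℂ) ≠ 0 := by exact_mod_cast (norm_ne_zero_iff.mpr hc)
    rw [map_div₀, Complex.conj_ofReal, mul_div_assoc', Complex.mul_conj', div_eq_iff hn]; ring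
  have hmain := h.orthF S A hA c s
  simp only [hs2] at hmain
  set q' : ℝ := q / (q - 1) with hq'
  have hconj : Real.HolderConjugate q q' := Real.HolderConjugate.conjExponent hq
  have hq'2 : 2 ≤ q' := by
    rw [hq', le_div_iff₀ (by linarith)]; linarith
  have hψb : ∀ x, ‖auxF g A s x‖ ≤ B * A.card := by
    intro x
    refine (auxF_bdd h.bdd A s x).trans ?_
    have : ∑ i ∈ A, ‖s i‖ ≤ ∑ i ∈ A, (1 : ℝ) := Finset.sum_le_sum fun i _ => hs1 i
    rw [Finset.sum_const, nsmul_eq_mul, mul_one] at this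
    gcongr
  have hψ2 : ∫ x, ‖auxF g A s x‖ ^ (2 : ℝ) ∂μ ≤ A.card := by
    have h1 := h.orthF A A subset_rfl s s
    have h2 : ∀ x, auxF g A s x * (starRingEnd ℂ) (auxF g A s x) =
        ((‖auxF g A s x‖ ^ (2 : ℝ) : ℝ) : ℂ) := by
      intro x
      rw [Complex.mul_conj']; norm_cast
    simp only [h2] at h1
    rw [integral_complex_ofReal] at h1
    have h3 : ∀ i, s i * (starRingEnd ℂ) (s i) = ((‖s i‖ ^ 2 : ℝ) : ℂ) := by
      intro i; rw [Complex.mul_conj']; norm_cast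
    simp only [h3] at h1
    rw [← Complex.ofReal_sum] at h1
    rw [Complex.ofReal_inj.mp h1]
    calc ∑ i ∈ A, ‖s i‖ ^ 2 ≤ ∑ i ∈ A, (1 : ℝ) := Finset.sum_le_sum fun i _ => by
          have := hs1 i
          have := norm_nonneg (s i)
          nlinarith
      _ = _ := by simp
  have hψq : ∫ x, ‖auxF g A s x‖ ^ q' ∂μ ≤ (B * A.card) ^ (q' - 2) * A.card := by
    calc ∫ x, ‖auxF g A s x‖ ^ q' ∂μ
        ≤ ∫ x, (B * A.card) ^ (q' - 2) * ‖auxF g A s x‖ ^ (2 : ℝ) ∂μ := by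
          apply integral_mono (h.intF A s q' (by linarith))
            ((h.intF A s 2 (by norm_num)).const_mul _)
          intro x
          simp only
          have : ‖auxF g A s x‖ ^ q' = ‖auxF g A s x‖ ^ (q' - 2) * ‖auxF g A s x‖ ^ (2 : ℝ) := by
            rw [← Real.rpow_add_of_nonneg (norm_nonneg _) (by linarith) (by norm_num)]
            congr 1; ring
          rw [this]
          apply mul_le_mul_of_nonneg_right _ (by positivity)
          exact Real.rpow_le_rpow (norm_nonneg _) (hψb x) (by linarith)
      _ = (B * A.card) ^ (q' - 2) * ∫ x, ‖auxF g A s x‖ ^ (2 : ℝ) ∂μ := by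
          rw [integral_const_mul]
      _ ≤ _ := by gcongr
  have hψn : (∫ x, ‖auxF g A s x‖ ^ q' ∂μ) ^ (1 / q') ≤ B * (A.card : ℝ) ^ (1 / q) := by
    have h0 : 0 ≤ ∫ x, ‖auxF g A s x‖ ^ q' ∂μ := integral_nonneg fun x => by positivity
    refine (Real.rpow_le_rpow h0 hψq (by positivity)).trans ?_
    have h1 : (B * A.card) ^ (q' - 2) * (A.card : ℝ) ≤ B ^ q' * (A.card : ℝ) ^ (q' - 1) := by
      rw [Real.mul_rpow (by linarith) hcard.le]
      have e1 : (A.card : ℝ) ^ (q' - 1) = (A.card : ℝ) ^ (q' - 2) * A.card := by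
        nth_rewrite 3 [← Real.rpow_one (A.card : ℝ)]
        rw [← Real.rpow_add hcard]; congr 1; ring
      rw [e1, mul_assoc]
      gcongr
      linarith
    refine (Real.rpow_le_rpow (by positivity) h1 (by positivity)).trans (le_of_eq ?_)
    rw [Real.mul_rpow (by positivity) (by positivity), ← Real.rpow_mul (by linarith),
      ← Real.rpow_mul hcard.le, mul_one_div_cancel (by linarith), Real.rpow_one]
    congr 2
    rw [hq']
    have : q - 1 ≠ 0 := by linarith
    field_simp
    ring
  have hmem : ∀ (T : Finset (Fin N)) (d : Fin N → ℂ) (r : ℝ≥0∞), MemLp (auxF g T d) r μ := by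
    intro T d r
    exact MemLp.of_bound (h.measF T d).aestronglyMeasurable _
      (Filter.Eventually.of_forall (auxF_bdd h.bdd T d))
  have hH := MeasureTheory.integral_mul_norm_le_Lp_mul_Lq hconj (hmem S c (ENNReal.ofReal q))
    (hmem A s (ENNReal.ofReal q'))
  have h1 : ∑ i ∈ A, ‖c i‖ = ‖∫ x, auxF g S c x * (starRingEnd ℂ) (auxF g A s x) ∂μ‖ := by
    rw [hmain, ← Complex.ofReal_sum, Complex.norm_real, Real.norm_of_nonneg (by positivity)]
  rw [h1]
  refine (norm_integral_le_integral_norm _).trans ?_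
  simp only [norm_mul, RCLike.norm_conj]
  refine hH.trans ?_
  rw [mul_comm]
  have h0 : 0 ≤ ∫ x, ‖auxF g S c x‖ ^ q ∂μ := integral_nonneg fun x => by positivity
  gcongr

lemma aux_homog {N : ℕ} (q C : ℝ) (hq : 0 < q) (P Q : (Fin N → ℂ) → ℝ)
    (hC : 0 ≤ C) (hP0 : ∀ c, 0 ≤ P c) (hQ0 : ∀ c, 0 ≤ Q c)
    (hP : ∀ (r : ℝ) c, 0 < r → P (fun i => (r : ℂ) * c i) = r ^ q * P c)
    (hQ : ∀ (r : ℝ) c, 0 < r → Q (fun i => (r : ℂ) * c i) = r ^ q * Q c)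
    (h : ∀ c, P c = 1 → 1 ≤ C * Q c) (c : Fin N → ℂ) : P c ≤ C * Q c := by
  rcases (hP0 c).eq_or_lt with h0 | h0
  · rw [← h0]; exact mul_nonneg hC (hQ0 c)
  set r : ℝ := (P c) ^ (-(1 / q)) with hr
  have hr0 : 0 < r := by positivity
  have hrq : r ^ q = (P c)⁻¹ := by
    rw [hr, ← Real.rpow_mul h0.le, neg_mul, one_div_mul_cancel hq.ne', Real.rpow_neg_one]
  have h1 := h (fun i => (r : ℂ) * c i) (by rw [hP r c hr0, hrq, inv_mul_cancel₀ h0.ne'])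
  rw [hQ r c hr0, hrq] at h1
  have h2 := mul_le_mul_of_nonneg_left h1 h0.le
  rw [mul_one] at h2
  refine h2.trans (le_of_eq ?_)
  field_simp

lemma auxF_smul {X : Type*} {N : ℕ} (g : Fin N → X → ℂ) (S : Finset (Fin N)) (r : ℂ)
    (c : Fin N → ℂ) (x : X) : auxF g S (fun i => r * c i) x = r * auxF g S c x := by
  unfold auxF
  rw [Finset.mul_sum]
  refine Finset.sum_congr rfl fun i _ => by ring

lemma aux_enum {N : ℕ} (hN : 0 < N) (R : ℝ) (hR : 0 ≤ R) (c : Fin N → ℂ) (S : Finset (Fin N)) :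
    ∀ (s : ℕ), S.card ≤ s → (∀ i ∈ S, ‖c i‖ ≤ R) →
    ∃ (e : Fin s → Fin N) (a : Fin s → ℂ), (∀ G : Fin N → ℂ, ∑ j, a j * G (e j) =
      ∑ i ∈ S, c i * G i) ∧ ∀ j, ‖a j‖ ≤ R := by
  induction S using Finset.induction_on with
  | empty =>
    intro s _ _
    exact ⟨fun _ => ⟨0, hN⟩, fun _ => 0, by simp, fun _ => by simpa using hR⟩
  | insert i S hi ih =>
    intro s hs hc
    rw [Finset.card_insert_of_notMem hi] at hs
    obtain ⟨s, rfl⟩ : ∃ s', s = s' + 1 := ⟨s - 1, by omega⟩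
    obtain ⟨e, a, h1, h2⟩ := ih s (by omega) (fun j hj => hc j (Finset.mem_insert_of_mem hj))
    refine ⟨Fin.cons i e, Fin.cons (c i) a, ?_, ?_⟩
    · intro G
      rw [Fin.sum_univ_succ, Finset.sum_insert hi]
      simp only [Fin.cons_zero, Fin.cons_succ, h1]
    · intro j
      refine Fin.cases ?_ (fun j => ?_) j
      · simpa using hc i (Finset.mem_insert_self _ _)
      · simpa using h2 j

lemma aux_round (K : ℕ) (δ R x : ℝ) (hδ : 0 < δ) (hx : |x| ≤ R) (hK : R / δ ≤ K) :
    ∃ k : Fin (2 * K + 1), |x - ((k : ℝ) - K) * δ| ≤ δ := by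
  have h1 := abs_le.mp hx
  have h2 : 0 ≤ x / δ + K := by
    have : -(R / δ) ≤ x / δ := by
      rw [← neg_div]; gcongr; exact h1.1
    linarith
  have h3 : x / δ + K ≤ 2 * K := by
    have : x / δ ≤ R / δ := by gcongr; exact h1.2
    linarith
  refine ⟨⟨⌊x / δ + K⌋₊, ?_⟩, ?_⟩
  · have := Nat.floor_le h2
    have h4 : ((⌊x / δ + K⌋₊ : ℕ) : ℝ) ≤ ((2 * K : ℕ) : ℝ) := by push_cast; linarith
    have := Nat.cast_le.mp h4
    omega
  · simp only
    have h4 := Nat.floor_le h2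
    have h5 := Nat.lt_floor_add_one (x / δ + K)
    set n : ℝ := (⌊x / δ + K⌋₊ : ℝ)
    have h6 : x - (n - K) * δ = (x / δ + K - n) * δ := by field_simp; ring
    rw [h6, abs_mul, abs_of_pos hδ, abs_of_nonneg (by linarith)]
    nlinarith

lemma AuxONS.step1 {X : Type*} [MeasurableSpace X] {μ : Measure X} [IsProbabilityMeasure μ] {N : ℕ}
    {g : Fin N → X → ℂ} {B : ℝ} (h : AuxONS μ g B) (p : ℝ) (hp : 1 < p) (hp2 : p ≤ 2) (hN : 0 < N)
    (s M : ℕ) (hs : 0 < s) (hM0 : 0 < M) (hM : 1024 * (s : ℝ) ^ 2 * B ^ 4 * (Real.log 2 + s *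
      Real.log (N * (2 * (128 * s * B ^ 2 + 1) + 1) ^ 2)) ≤ M) :
    ∃ ξ : Fin M → X, ∀ q : ℝ, (q = p ∨ q = 2) → ∀ (S : Finset (Fin N)), S.card ≤ s →
      ∀ c, ∫ x, ‖auxF g S c x‖ ^ q ∂μ ≤ 32 * ((M : ℝ)⁻¹ * ∑ j, ‖auxF g S c (ξ j)‖ ^ q) := by
  have hB := h.one_le
  have hs' : (1 : ℝ) ≤ s := by exact_mod_cast hs
  have hM' : (0 : ℝ) < M := by exact_mod_cast hM0
  set K : ℕ := ⌈128 * s * B ^ 2⌉₊ with hK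
  set δ : ℝ := 1 / (128 * s * B) with hδ
  have hδ0 : 0 < δ := by positivity
  have hKδ : B / δ ≤ K := by
    have : B / δ = 128 * s * B ^ 2 := by rw [hδ]; field_simp
    rw [this]; exact Nat.le_ceil _
  have hK2 : (K : ℝ) ≤ 128 * s * B ^ 2 + 1 := (Nat.ceil_lt_add_one (by positivity)).le
  set val : Fin (2 * K + 1) × Fin (2 * K + 1) → ℂ := fun k =>
    (((((k.1 : ℕ) : ℝ) - K) * δ : ℝ) : ℂ) + (((((k.2 : ℕ) : ℝ) - K) * δ : ℝ) : ℂ) * Complex.I with hval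
  have hvalb : ∀ k, ‖val k‖ ≤ 4 * B := by
    intro k
    have h1 : ∀ k : Fin (2 * K + 1), |(((k : ℕ) : ℝ) - K) * δ| ≤ 2 * B := by
      intro k
      have hk : ((k : ℕ) : ℝ) ≤ 2 * K := by exact_mod_cast (by omega : (k : ℕ) ≤ 2 * K)
      have hk0 : (0 : ℝ) ≤ ((k : ℕ) : ℝ) := by positivity
      rw [abs_mul, abs_of_pos hδ0]
      have h2 : |((k : ℕ) : ℝ) - K| ≤ K := by rw [abs_le]; constructor <;> linarith
      calc _ ≤ (128 * s * B ^ 2 + 1) * δ := by gcongr; exact h2.trans hK2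
        _ = B + δ := by rw [hδ]; field_simp
        _ ≤ 2 * B := by
          have : δ ≤ 1 := by
            rw [hδ, div_le_one (by positivity)]
            nlinarith
          linarith
    simp only [hval]
    refine (norm_add_le _ _).trans ?_
    rw [norm_mul, Complex.norm_I, mul_one, Complex.norm_real, Complex.norm_real, Real.norm_eq_abs,
      Real.norm_eq_abs]
    linarith [h1 k.1, h1 k.2]
  let I := Bool × (Fin s → Fin N × (Fin (2 * K + 1) × Fin (2 * K + 1)))
  set qq : Bool → ℝ := fun b => if b then p else 2 with hqq
  have hqq1 : ∀ b, 1 ≤ qq b ∧ qq b ≤ 2 := by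
    intro b; simp only [hqq]; split_ifs <;> constructor <;> linarith
  set H : (Fin s → Fin N × (Fin (2 * K + 1) × Fin (2 * K + 1))) → X → ℂ := fun e x =>
    ∑ j, val (e j).2 * g (e j).1 x with hH
  have hHb : ∀ e x, ‖H e x‖ ≤ 4 * s * B ^ 2 := by
    intro e x
    simp only [hH]
    refine (norm_sum_le _ _).trans ?_
    have : ∀ j ∈ Finset.univ, ‖val (e j).2 * g (e j).1 x‖ ≤ 4 * B * B := by
      intro j _
      rw [norm_mul]
      exact mul_le_mul (hvalb _) (h.bdd _ _) (norm_nonneg _) (by positivity)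
    refine (Finset.sum_le_sum this).trans (le_of_eq ?_)
    simp; ring
  have hHm : ∀ e, Measurable (H e) := by
    intro e
    exact Finset.measurable_fun_sum _ fun j _ => (h.meas _).const_mul _
  set φ : I → X → ℝ := fun i x => ‖H i.2 x‖ ^ (qq i.1) with hφ
  have hb1 : (1 : ℝ) ≤ 4 * s * B ^ 2 := by nlinarith
  have hφb : ∀ i x, φ i x ≤ 16 * (s : ℝ) ^ 2 * B ^ 4 := by
    intro i x
    have h1 := hqq1 i.1
    simp only [hφ]
    calc ‖H i.2 x‖ ^ (qq i.1) ≤ (4 * s * B ^ 2) ^ (qq i.1) :=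
          Real.rpow_le_rpow (norm_nonneg _) (hHb _ _) (by linarith)
      _ ≤ (4 * s * B ^ 2) ^ (2 : ℝ) := Real.rpow_le_rpow_of_exponent_le hb1 h1.2
      _ = _ := by rw [Real.rpow_two]; ring
  have hφ0 : ∀ i x, 0 ≤ φ i x := fun i x => by simp only [hφ]; positivity
  have hφint : ∀ i, Integrable (φ i) μ := by
    intro i
    refine Integrable.of_bound (C := 16 * (s : ℝ) ^ 2 * B ^ 4)
      ((hHm i.2).norm.pow_const _).aestronglyMeasurable ?_
    · refine Filter.Eventually.of_forall fun x => ?_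
      rw [Real.norm_of_nonneg (hφ0 i x)]
      exact hφb i x
  have hcard : (Fintype.card I : ℝ) = 2 * ((N : ℝ) * ((2 * K + 1 : ℕ) : ℝ) ^ 2) ^ s := by
    simp only [I, Fintype.card_prod, Fintype.card_bool, Fintype.card_fun, Fintype.card_fin]
    push_cast; ring
  have hNr : (1 : ℝ) ≤ N := by exact_mod_cast hN
  set L : ℝ := Real.log (Fintype.card I) with hL
  have hcardpos : (0 : ℝ) < Fintype.card I := by rw [hcard]; positivity
  have hLle : L ≤ Real.log 2 + s * Real.log (N * (2 * (128 * s * B ^ 2 + 1) + 1) ^ 2) := by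
    rw [hL, hcard, Real.log_mul (by norm_num) (by positivity), Real.log_pow]
    gcongr
    push_cast
    linarith
  obtain ⟨ξ, hξ⟩ := aux_select φ (fun _ => 16 * (s : ℝ) ^ 2 * B ^ 4) (fun i => ∫ x, φ i x ∂μ)
    (fun _ => L) (fun i => by positivity) hφ0 hφb (by
      intro a ha
      have h1 : Integrable (fun x => ∑ i, a i * φ i x) μ :=
        MeasureTheory.integrable_finsetSum _ fun i _ => (hφint i).const_mul _
      obtain ⟨x, hx⟩ := MeasureTheory.exists_integral_le h1
      refine ⟨x, le_trans (le_of_eq ?_) hx⟩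
      rw [MeasureTheory.integral_finsetSum _ fun i _ => (hφint i).const_mul _]
      refine Finset.sum_congr rfl fun i _ => ?_
      rw [MeasureTheory.integral_const_mul]) (by
      rw [Finset.sum_const, Finset.card_univ, nsmul_eq_mul, hL, Real.exp_neg,
        Real.exp_log hcardpos, mul_inv_cancel₀ hcardpos.ne']) M
  refine ⟨ξ, fun q hq S hS c => ?_⟩
  obtain ⟨b, hbq⟩ : ∃ b, qq b = q := by
    rcases hq with rfl | rfl
    · exact ⟨true, by simp [hqq]⟩
    · exact ⟨false, by simp [hqq]⟩
  have hq12 := hqq1 b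
  rw [hbq] at hq12
  have hq1 : 1 < q := by rcases hq with rfl | rfl <;> linarith
  have hsm : ∀ (r : ℝ) (c : Fin N → ℂ) (x : X), 0 < r →
      ‖auxF g S (fun i => (r : ℂ) * c i) x‖ ^ q = r ^ q * ‖auxF g S c x‖ ^ q := by
    intro r c x hr
    rw [auxF_smul, norm_mul, Complex.norm_real, Real.norm_of_nonneg hr.le,
      Real.mul_rpow hr.le (norm_nonneg _)]
  refine aux_homog q 32 (by linarith) (fun c => ∫ x, ‖auxF g S c x‖ ^ q ∂μ)
    (fun c => (M : ℝ)⁻¹ * ∑ j, ‖auxF g S c (ξ j)‖ ^ q) (by norm_num)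
    (fun c => integral_nonneg fun x => by positivity) (fun c => by positivity) ?_ ?_ ?_ c
  · intro r c hr
    simp only [hsm r c _ hr]
    rw [integral_const_mul]
  · intro r c hr
    simp only [hsm r c _ hr]
    rw [← Finset.mul_sum]; ring
  intro c hc
  have hcb : ∀ i ∈ S, ‖c i‖ ≤ B := by
    intro i hi
    have h1 := h.inc q hq1 hq12.2 S {i} (by simpa using hi) c
    simpa [hc] using h1
  obtain ⟨e, a, hea, haB⟩ := aux_enum hN B (by linarith) c S s hS hcb
  have hround : ∀ j, ∃ k, ‖a j - val k‖ ≤ 2 * δ := by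
    intro j
    obtain ⟨k1, hk1⟩ := aux_round K δ B (a j).re hδ0 ((Complex.abs_re_le_norm _).trans (haB j)) hKδ
    obtain ⟨k2, hk2⟩ := aux_round K δ B (a j).im hδ0 ((Complex.abs_im_le_norm _).trans (haB j)) hKδ
    refine ⟨(k1, k2), ?_⟩
    refine (Complex.norm_le_abs_re_add_abs_im _).trans ?_
    have e1 : (a j - val (k1, k2)).re = (a j).re - (((k1 : ℕ) : ℝ) - K) * δ := by
      simp [hval]
    have e2 : (a j - val (k1, k2)).im = (a j).im - (((k2 : ℕ) : ℝ) - K) * δ := by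
      simp [hval]
    rw [e1, e2]; linarith
  choose k hk using hround
  set i0 : I := (b, fun j => (e j, k j)) with hi0
  have hdiff : ∀ x, ‖auxF g S c x - H i0.2 x‖ ≤ 1 / 64 := by
    intro x
    have : auxF g S c x = ∑ j, a j * g (e j) x := (hea fun i => g i x).symm
    rw [this]
    simp only [hH, hi0]
    rw [← Finset.sum_sub_distrib]
    refine (norm_sum_le _ _).trans ?_
    have : ∀ j ∈ Finset.univ, ‖a j * g (e j) x - val (k j) * g (e j) x‖ ≤ 2 * δ * B := by
      intro j _
      rw [← sub_mul, norm_mul]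
      exact mul_le_mul (hk j) (h.bdd _ _) (norm_nonneg _) (by positivity)
    refine (Finset.sum_le_sum this).trans (le_of_eq ?_)
    simp [hδ]; field_simp; norm_num
  have hdq : ∀ x, ‖auxF g S c x - H i0.2 x‖ ^ q ≤ 1 / 64 := by
    intro x
    calc _ ≤ (1 / 64 : ℝ) ^ q := Real.rpow_le_rpow (norm_nonneg _) (hdiff x) (by linarith)
      _ ≤ (1 / 64 : ℝ) ^ (1 : ℝ) :=
        Real.rpow_le_rpow_of_exponent_ge (by norm_num) (by norm_num) hq12.1
      _ = 1 / 64 := by rw [Real.rpow_one]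
  have hφi0 : ∀ x, φ i0 x = ‖H i0.2 x‖ ^ q := by
    intro x; simp only [hφ, hi0, hbq]
  have hfh : ∀ x, ‖auxF g S c x‖ ^ q ≤ 2 * φ i0 x + 1 / 32 := by
    intro x
    have h1 := aux_clark_pt q (by linarith) hq12.2 (H i0.2 x) (auxF g S c x - H i0.2 x)
    rw [add_sub_cancel] at h1
    rw [hφi0]
    have h2 : 0 ≤ ‖H i0.2 x - (auxF g S c x - H i0.2 x)‖ ^ q := by positivity
    linarith [hdq x]
  have hhf : ∀ x, φ i0 x ≤ 2 * ‖auxF g S c x‖ ^ q + 1 / 32 := by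
    intro x
    have h1 := aux_clark_pt q (by linarith) hq12.2 (auxF g S c x) (auxF g S c x - H i0.2 x)
    rw [sub_sub_cancel] at h1
    rw [hφi0]
    have h2 : 0 ≤ ‖auxF g S c x + (auxF g S c x - H i0.2 x)‖ ^ q := by positivity
    linarith [hdq x]
  have hA : (15 / 32 : ℝ) ≤ ∫ x, φ i0 x ∂μ := by
    have h1 : ∫ x, ‖auxF g S c x‖ ^ q ∂μ ≤ ∫ x, (2 * φ i0 x + 1 / 32) ∂μ := by
      apply integral_mono (h.intF S c q (by linarith))
        (((hφint i0).const_mul 2).add (integrable_const _)) hfh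
    rw [integral_add ((hφint i0).const_mul 2) (integrable_const _), integral_const_mul, hc] at h1
    simp at h1
    linarith
  have h5 := hξ i0
  have h6 : ∑ j, φ i0 (ξ j) ≤ 2 * ∑ j, ‖auxF g S c (ξ j)‖ ^ q + M * (1 / 32) := by
    refine (Finset.sum_le_sum fun j _ => hhf (ξ j)).trans (le_of_eq ?_)
    rw [Finset.sum_add_distrib, ← Finset.mul_sum]; simp
  have h7 : 16 * (s : ℝ) ^ 2 * B ^ 4 * L ≤ M / 64 := by
    have := mul_le_mul_of_nonneg_left hLle (show 0 ≤ 1024 * (s : ℝ) ^ 2 * B ^ 4 by positivity)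
    linarith
  have h8 : (M : ℝ) * (15 / 64) ≤ M * ((∫ x, φ i0 x ∂μ) / 2) := by
    apply mul_le_mul_of_nonneg_left _ hM'.le
    linarith
  have h9 : (M : ℝ) ≤ 32 * ∑ j, ‖auxF g S c (ξ j)‖ ^ q := by linarith
  rw [mul_left_comm, ← div_eq_inv_mul, le_div_iff₀ hM']
  linarith

/-- positive parts of a complex number in four directions -/
def auxPt (k : Fin 4) (c : ℂ) : ℝ := max 0 ((-Complex.I) ^ (k : ℕ) * c).re

lemma auxPt_sum (c : ℂ) : ∑ k : Fin 4, (auxPt k c : ℂ) * Complex.I ^ (k : ℕ) = c := by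
  have h3 : Complex.I ^ 3 = -Complex.I := by rw [pow_succ, Complex.I_sq]; ring
  apply Complex.ext
  · simp [Fin.sum_univ_four, auxPt, h3]
    rcases le_total 0 c.re with h | h
    · rw [max_eq_right h, max_eq_left (by linarith)]; ring
    · rw [max_eq_left h, max_eq_right (by linarith)]; ring
  · have h4 : (-Complex.I) ^ 3 = Complex.I := by
      rw [neg_pow, h3]; ring
    simp [Fin.sum_univ_four, auxPt, h3, h4]
    rcases le_total 0 c.im with h | h
    · rw [max_eq_right h, max_eq_left (by linarith)]; ring
    · rw [max_eq_left h, max_eq_right (by linarith)]; ring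

lemma auxPt_sum_le (c : ℂ) : ∑ k : Fin 4, auxPt k c ≤ 2 * ‖c‖ := by
  have h3 : Complex.I ^ 3 = -Complex.I := by rw [pow_succ, Complex.I_sq]; ring
  have h4 : (-Complex.I) ^ 3 = Complex.I := by
    rw [neg_pow, h3]; ring
  have h1 := Complex.abs_re_le_norm c
  have h2 := Complex.abs_im_le_norm c
  have e : ∑ k : Fin 4, auxPt k c = |c.re| + |c.im| := by
    simp [Fin.sum_univ_four, auxPt, h4]
    rcases le_total 0 c.im with h | h <;> rcases le_total 0 c.re with h' | h' <;>
      simp [h, h', abs_of_nonneg, abs_of_nonpos] <;> ring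
  rw [e]; linarith

/-- dictionary -/
def auxDict {X : Type*} {N : ℕ} (g : Fin N → X → ℂ) (R : ℝ) :
    Option (Fin N × Fin 4) → X → ℂ
  | none => 0
  | some a => fun y => (2 * R : ℝ) * (Complex.I ^ (a.2 : ℕ) * g a.1 y)

lemma aux_approx {M N : ℕ} (hM : 0 < M) (g : Fin N → Fin M → ℂ) (B R ε : ℝ) (hB : 0 < B)
    (hR : 0 < R) (hε : 0 < ε) (hg : ∀ i y, ‖g i y‖ ≤ B) (S : Finset (Fin N)) (c : Fin N → ℂ)
    (hc : ∑ i ∈ S, ‖c i‖ ≤ R) (hεR : ε ≤ 2 * R * B) (n : ℕ) (hn0 : 0 < n)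
    (hn : 16 * (2 * R * B) ^ 2 * Real.log (4 * M) ≤ n * ε ^ 2) :
    ∃ D : Fin n → Option (Fin N × Fin 4), ∀ y,
      ‖auxF g S c y - (n : ℂ)⁻¹ * ∑ j, auxDict g R (D j) y‖ ≤ 2 * ε := by
  have : Nonempty (Fin M) := ⟨⟨0, hM⟩⟩
  set w' : Fin N × Fin 4 → ℝ := fun a => if a.1 ∈ S then auxPt a.2 (c a.1) / (2 * R) else 0 with hw'
  have hw'0 : ∀ a, 0 ≤ w' a := by
    intro a; simp only [hw']
    split_ifs
    · exact div_nonneg (le_max_left _ _) (by positivity)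
    · exact le_rfl
  have hw's : ∑ a, w' a ≤ 1 := by
    rw [Fintype.sum_prod_type]
    have : ∀ i, ∑ k, w' (i, k) = if i ∈ S then (∑ k, auxPt k (c i)) / (2 * R) else 0 := by
      intro i
      simp only [hw']
      split_ifs
      · rw [Finset.sum_div]
      · simp
    simp only [this]
    rw [Finset.sum_ite_mem, Finset.univ_inter, ← Finset.sum_div, div_le_one (by positivity)]
    calc ∑ i ∈ S, ∑ k, auxPt k (c i) ≤ ∑ i ∈ S, 2 * ‖c i‖ :=
          Finset.sum_le_sum fun i _ => auxPt_sum_le _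
      _ ≤ 2 * R := by rw [← Finset.mul_sum]; linarith
  set w : Option (Fin N × Fin 4) → ℝ := fun o => o.elim (1 - ∑ a, w' a) w' with hw
  set z : Option (Fin N × Fin 4) → Fin M × Fin 4 → ℝ := fun d yk =>
    (Complex.I ^ (yk.2 : ℕ) * auxDict g R d yk.1).re with hz
  have hmean : ∀ yk : Fin M × Fin 4, ∑ d, w d * z d yk =
      (Complex.I ^ (yk.2 : ℕ) * auxF g S c yk.1).re := by
    intro yk
    have h1 : ∑ a, (w' a : ℂ) * auxDict g R (some a) yk.1 = auxF g S c yk.1 := by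
      rw [Fintype.sum_prod_type]
      unfold auxF
      rw [← Finset.univ_inter S, ← Finset.sum_ite_mem]
      refine Finset.sum_congr rfl fun i _ => ?_
      simp only [hw', auxDict]
      split_ifs with hi
      · have h2 : ∀ k : Fin 4, ((auxPt k (c i) / (2 * R) : ℝ) : ℂ) *
            (((2 * R : ℝ) : ℂ) * (Complex.I ^ (k : ℕ) * g i yk.1)) =
            ((auxPt k (c i) : ℂ) * Complex.I ^ (k : ℕ)) * g i yk.1 := by
          intro k
          have : (R : ℂ) ≠ 0 := by exact_mod_cast hR.ne'
          push_cast
          field_simp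
        simp only [h2]
        rw [← Finset.sum_mul, auxPt_sum]
      · simp
    rw [Fintype.sum_option]
    have h3 : z none yk = 0 := by simp [hz, auxDict]
    rw [h3, mul_zero, zero_add, ← h1, Finset.mul_sum, Complex.re_sum]
    refine Finset.sum_congr rfl fun a _ => ?_
    simp only [hw, hz, Option.elim]
    rw [mul_left_comm, Complex.re_ofReal_mul]
  have hcard : (Fintype.card (Fin M × Fin 4) : ℝ) = 4 * M := by
    simp; ring
  obtain ⟨D, hD⟩ := aux_maurey w (by
      intro d; rcases d with _ | a
      · simp only [hw, Option.elim]; linarith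
      · exact hw'0 a) (by rw [Fintype.sum_option]; simp [hw]) z (2 * R * B) ε (by positivity) hε
      hεR (by
      intro d yk
      simp only [hz]
      refine (Complex.abs_re_le_norm _).trans ?_
      rw [norm_mul, norm_pow, Complex.norm_I, one_pow, one_mul]
      rcases d with _ | a
      · simp [auxDict]; positivity
      · simp only [auxDict]
        rw [norm_mul, norm_mul, norm_pow, Complex.norm_I, one_pow, one_mul, Complex.norm_real,
          Real.norm_of_nonneg (by positivity)]
        gcongr
        exact hg _ _) n (by rw [hcard]; exact hn)
  refine ⟨D, fun y => ?_⟩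
  have hn0' : (0 : ℝ) < n := by exact_mod_cast hn0
  set Δ : ℂ := auxF g S c y - (n : ℂ)⁻¹ * ∑ j, auxDict g R (D j) y with hΔ
  have hk : ∀ k : Fin 4, -(Complex.I ^ (k : ℕ) * Δ).re ≤ ε := by
    intro k
    have h1 := hD (y, k)
    rw [hmean (y, k)] at h1
    simp only [hz] at h1
    rw [← Complex.re_sum, ← Finset.mul_sum] at h1
    have h2 : n * (-(Complex.I ^ (k : ℕ) * Δ).re) =
        (Complex.I ^ (k : ℕ) * ∑ j, auxDict g R (D j) y).re -
          n * (Complex.I ^ (k : ℕ) * auxF g S c y).re := by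
      rw [hΔ, mul_sub, Complex.sub_re]
      have : Complex.I ^ (k : ℕ) * ((n : ℂ)⁻¹ * ∑ j, auxDict g R (D j) y) =
        (((n : ℝ)⁻¹ : ℝ) : ℂ) * (Complex.I ^ (k : ℕ) * ∑ j, auxDict g R (D j) y) := by
        push_cast; ring
      rw [this, Complex.re_ofReal_mul]
      field_simp
      ring
    rw [← h2] at h1
    exact le_of_mul_le_mul_left h1 hn0'
  have h3 : Complex.I ^ 3 = -Complex.I := by rw [pow_succ, Complex.I_sq]; ring
  have k0 := hk 0
  have k1 := hk 1
  have k2 := hk 2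
  have k3 := hk 3
  simp [h3] at k0 k1 k2 k3
  refine (Complex.norm_le_abs_re_add_abs_im _).trans ?_
  have a1 : |Δ.re| ≤ ε := by rw [abs_le]; constructor <;> linarith
  have a2 : |Δ.im| ≤ ε := by rw [abs_le]; constructor <;> linarith
  linarith

/-- normalised sparse functions -/
def auxT {M N : ℕ} (g : Fin N → Fin M → ℂ) (s : ℕ) (p : ℝ) : Set (Fin M → ℂ) :=
  {f | ∃ (S : Finset (Fin N)) (c : Fin N → ℂ), S.card ≤ s ∧ f = auxF g S c ∧
    (M : ℝ)⁻¹ * ∑ y, ‖f y‖ ^ p = 1}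

lemma auxF_sub {X : Type*} {N : ℕ} (g : Fin N → X → ℂ) (S S' : Finset (Fin N))
    (c c' : Fin N → ℂ) : ∃ d, auxF g S c - auxF g S' c' = auxF g (S ∪ S') d := by
  refine ⟨fun i => (if i ∈ S then c i else 0) - (if i ∈ S' then c' i else 0), ?_⟩
  ext x
  simp only [auxF, Pi.sub_apply, sub_mul, ite_mul, zero_mul]
  rw [Finset.sum_sub_distrib, Finset.sum_ite_mem, Finset.sum_ite_mem,
    Finset.inter_eq_right.mpr Finset.subset_union_left,
    Finset.inter_eq_right.mpr Finset.subset_union_right]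

lemma aux_net_step {M N : ℕ} (hM : 0 < M) (hN : 0 < N) (g : Fin N → Fin M → ℂ) (B A p : ℝ)
    (hB : 1 ≤ B) (hA : 1 ≤ A) (hp : 1 < p) (hp2 : p ≤ 2) (hg : ∀ i y, ‖g i y‖ ≤ B) (s : ℕ)
    (hs : 0 < s)
    (h2 : ∀ (S : Finset (Fin N)) (c : Fin N → ℂ), S.card ≤ 2 * s → ∑ i ∈ S, ‖c i‖ ≤
      A * Real.sqrt (2 * s) * Real.sqrt ((M : ℝ)⁻¹ * ∑ y, ‖auxF g S c y‖ ^ (2 : ℝ)))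
    (lam : ℝ) (hlam : 0 < lam) (hlamp : lam ^ p ≤ 4 * A ^ 2 * B ^ 2 * s)
    (H : Finset (Fin M → ℂ)) (hHT : ∀ h ∈ H, h ∈ auxT g s p)
    (hnet : ∀ f ∈ auxT g s p, ∃ h ∈ H, ∀ y, ‖f y - h y‖ ≤ lam) (hT : (auxT g s p).Nonempty) :
    ∃ H' : Finset (Fin M → ℂ), (∀ h ∈ H', h ∈ auxT g s p) ∧
      (∀ f ∈ auxT g s p, ∃ h ∈ H', ∀ y, ‖f y - h y‖ ≤ lam / 2) ∧
      Real.log H'.card ≤ Real.log H.card + 65536 * A ^ 2 * B ^ 2 * s * Real.log (4 * M) *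
        Real.log (5 * N) * lam ^ (-p) := by
  have hs' : (1 : ℝ) ≤ s := by exact_mod_cast hs
  have hM' : (1 : ℝ) ≤ M := by exact_mod_cast hM
  have hN' : (1 : ℝ) ≤ N := by exact_mod_cast hN
  set R : ℝ := A * Real.sqrt (8 * s * lam ^ (2 - p)) with hR
  have hR0 : 0 < R := by positivity
  have hR2 : R ^ 2 = 8 * A ^ 2 * s * lam ^ (2 - p) := by
    rw [hR, mul_pow, Real.sq_sqrt (by positivity)]; ring
  have hl2 : lam ^ (2 - p) = lam ^ 2 * lam ^ (-p) := by
    rw [← Real.rpow_two, ← Real.rpow_add hlam]; congr 1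
  have hlinv : lam ^ (-p) * lam ^ p = 1 := by
    rw [← Real.rpow_add hlam]; simp
  have hlp0 : 0 < lam ^ (-p) := by positivity
  have hq : 1 ≤ 4 * A ^ 2 * B ^ 2 * s * lam ^ (-p) := by
    rw [← hlinv, mul_comm]; gcongr
  have hlog4 : 1 ≤ Real.log (4 * M) := by
    rw [Real.le_log_iff_exp_le (by positivity)]
    have := Real.exp_one_lt_d9; linarith
  have hlog5 : 0 ≤ Real.log (5 * N) := Real.log_nonneg (by linarith)
  set Z : ℝ := 32768 * A ^ 2 * B ^ 2 * s * lam ^ (-p) * Real.log (4 * M) with hZ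
  have hZ1 : 1 ≤ Z := by
    have : Z = 8192 * ((4 * A ^ 2 * B ^ 2 * s * lam ^ (-p)) * Real.log (4 * M)) := by rw [hZ]; ring
    rw [this]; nlinarith
  set n : ℕ := ⌈Z⌉₊ with hn
  have hnZ : Z ≤ n := Nat.le_ceil _
  have hn0 : 0 < n := Nat.ceil_pos.mpr (by linarith)
  have hn2 : (n : ℝ) ≤ 2 * Z := by
    have := Nat.ceil_lt_add_one (show 0 ≤ Z by linarith); linarith
  set E := H ×ˢ (Finset.univ : Finset (Fin n → Option (Fin N × Fin 4))) with hE
  set P : (Fin M → ℂ) × (Fin n → Option (Fin N × Fin 4)) → (Fin M → ℂ) → Prop := fun e f =>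
    f ∈ auxT g s p ∧ ∀ y, ‖f y - e.1 y - (n : ℂ)⁻¹ * ∑ j, auxDict g R (e.2 j) y‖ ≤ lam / 4 with hP
  set f0 := hT.some with hf0
  have hf0T : f0 ∈ auxT g s p := hT.some_mem
  set ch : (Fin M → ℂ) × (Fin n → Option (Fin N × Fin 4)) → (Fin M → ℂ) := fun e =>
    if h : ∃ f, P e f then h.choose else f0 with hch
  have hnet' : ∀ f ∈ auxT g s p, ∃ h ∈ E.image ch, ∀ y, ‖f y - h y‖ ≤ lam / 2 := by
    intro f hf
    obtain ⟨h, hhH, hfh⟩ := hnet f hf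
    obtain ⟨S, c, hS, hfS, hf1⟩ := hf
    obtain ⟨S', c', hS', hfS', hf1'⟩ := hHT h hhH
    obtain ⟨d, hd⟩ := auxF_sub g S S' c c'
    rw [← hfS, ← hfS'] at hd
    have hcard : (S ∪ S').card ≤ 2 * s := (Finset.card_union_le _ _).trans (by omega)
    have hl1 := h2 (S ∪ S') d hcard
    have havg : (M : ℝ)⁻¹ * ∑ y, ‖auxF g (S ∪ S') d y‖ ^ (2 : ℝ) ≤ 4 * lam ^ (2 - p) := by
      rw [← hd]
      have h1 : ∀ y, ‖(f - h) y‖ ^ (2 : ℝ) ≤ lam ^ (2 - p) * (2 * ‖f y‖ ^ p + 2 * ‖h y‖ ^ p) := by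
        intro y
        have e1 : ‖(f - h) y‖ ^ (2 : ℝ) = ‖(f - h) y‖ ^ (2 - p) * ‖(f - h) y‖ ^ p := by
          rw [← Real.rpow_add_of_nonneg (norm_nonneg _) (by linarith) (by linarith)]
          congr 1; ring
        rw [e1]
        have e2 := aux_clark_pt p (by linarith) hp2 (f y) (h y)
        have e3 : 0 ≤ ‖f y + h y‖ ^ p := by positivity
        apply mul_le_mul _ (by rw [Pi.sub_apply]; linarith) (by positivity) (by positivity)
        exact Real.rpow_le_rpow (norm_nonneg _) (hfh y) (by linarith)
      calc _ ≤ (M : ℝ)⁻¹ * ∑ y, lam ^ (2 - p) * (2 * ‖f y‖ ^ p + 2 * ‖h y‖ ^ p) := by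
            gcongr with y; exact h1 y
        _ = lam ^ (2 - p) * (2 * ((M : ℝ)⁻¹ * ∑ y, ‖f y‖ ^ p) +
              2 * ((M : ℝ)⁻¹ * ∑ y, ‖h y‖ ^ p)) := by
            rw [← Finset.mul_sum, Finset.sum_add_distrib, ← Finset.mul_sum, ← Finset.mul_sum]; ring
        _ = _ := by rw [hf1, hf1']; ring
    have hlR : ∑ i ∈ S ∪ S', ‖d i‖ ≤ R := by
      refine hl1.trans ?_
      rw [mul_assoc, ← Real.sqrt_mul (by positivity), hR]
      apply mul_le_mul_of_nonneg_left (Real.sqrt_le_sqrt ?_) (by linarith)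
      calc 2 * (s : ℝ) * ((M : ℝ)⁻¹ * ∑ y, ‖auxF g (S ∪ S') d y‖ ^ (2 : ℝ)) ≤
          2 * s * (4 * lam ^ (2 - p)) := by gcongr
        _ = _ := by ring
    have hRB : (2 * R * B) ^ 2 = 32 * A ^ 2 * B ^ 2 * s * lam ^ (-p) * lam ^ 2 := by
      rw [mul_pow, mul_pow, hR2, hl2]; ring
    obtain ⟨D, hD⟩ := aux_approx hM g B R (lam / 8) (by linarith) hR0 (by linarith) hg (S ∪ S') d hlR
      (by
        apply (sq_le_sq₀ (by positivity) (by positivity)).mp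
        rw [hRB]
        have : 1 * lam ^ 2 ≤ (4 * A ^ 2 * B ^ 2 * s * lam ^ (-p)) * lam ^ 2 := by gcongr
        nlinarith [sq_nonneg lam]) n hn0 (by
        rw [hRB]
        calc _ = Z * (lam / 8) ^ 2 := by rw [hZ]; ring
          _ ≤ _ := by gcongr)
    have hex : ∃ f, P (h, D) f := by
      refine ⟨f, ⟨S, c, hS, hfS, hf1⟩, fun y => ?_⟩
      have := hD y
      rw [← hd, Pi.sub_apply] at this
      linarith
    refine ⟨ch (h, D), Finset.mem_image_of_mem _ (by simp [hE, hhH]), fun y => ?_⟩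
    have hc1 : ch (h, D) = hex.choose := by simp only [hch]; rw [dif_pos hex]
    rw [hc1]
    have hc2 := hex.choose_spec.2 y
    have := hD y
    rw [← hd, Pi.sub_apply] at this
    have e1 : f y - hex.choose y = (f y - h y - (n : ℂ)⁻¹ * ∑ j, auxDict g R (D j) y) -
      (hex.choose y - h y - (n : ℂ)⁻¹ * ∑ j, auxDict g R (D j) y) := by ring
    rw [e1]
    refine (norm_sub_le _ _).trans ?_
    simp only at hc2
    linarith
  refine ⟨E.image ch, ?_, hnet', ?_⟩
  · intro h hh
    obtain ⟨e, -, rfl⟩ := Finset.mem_image.mp hh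
    simp only [hch]
    split_ifs with hex
    · exact hex.choose_spec.1
    · exact hf0T
  · have hpos : 0 < (E.image ch).card := by
      obtain ⟨h, hh, -⟩ := hnet' f0 hf0T
      exact Finset.card_pos.mpr ⟨h, hh⟩
    have hHpos : 0 < H.card := by
      obtain ⟨h, hh, -⟩ := hnet f0 hf0T
      exact Finset.card_pos.mpr ⟨h, hh⟩
    have hc1 : ((E.image ch).card : ℝ) ≤ H.card * (5 * N : ℝ) ^ n := by
      have h1 : (E.image ch).card ≤ H.card * (5 * N) ^ n := by
        refine Finset.card_image_le.trans ?_
        rw [hE, Finset.card_product, Finset.card_univ, Fintype.card_fun, Fintype.card_option,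
          Fintype.card_prod, Fintype.card_fin, Fintype.card_fin, Fintype.card_fin]
        gcongr
        omega
      exact_mod_cast h1
    have hHpos' : (0 : ℝ) < H.card := by exact_mod_cast hHpos
    calc Real.log ((E.image ch).card : ℝ) ≤ Real.log (H.card * (5 * N : ℝ) ^ n) :=
          Real.log_le_log (by exact_mod_cast hpos) hc1
      _ = Real.log H.card + n * Real.log (5 * N) := by
          rw [Real.log_mul hHpos'.ne' (by positivity), Real.log_pow]
      _ ≤ Real.log H.card + 2 * Z * Real.log (5 * N) := by gcongr
      _ = _ := by rw [hZ]; ring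

lemma aux_nets {M N : ℕ} (hM : 0 < M) (hN : 0 < N) (g : Fin N → Fin M → ℂ) (B A p : ℝ)
    (hB : 1 ≤ B) (hA : 1 ≤ A) (hp : 1 < p) (hp2 : p ≤ 2) (hg : ∀ i y, ‖g i y‖ ≤ B) (s : ℕ)
    (hs : 0 < s)
    (h2 : ∀ (S : Finset (Fin N)) (c : Fin N → ℂ), S.card ≤ 2 * s → ∑ i ∈ S, ‖c i‖ ≤
      A * Real.sqrt (2 * s) * Real.sqrt ((M : ℝ)⁻¹ * ∑ y, ‖auxF g S c y‖ ^ (2 : ℝ)))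
    (Lam : ℝ) (hlam : 0 < Lam) (hlamp : Lam ^ p ≤ 4 * A ^ 2 * B ^ 2 * s)
    (hT : (auxT g s p).Nonempty)
    (hsup : ∀ f ∈ auxT g s p, ∀ y, ‖f y‖ ≤ Lam / 2) (k : ℕ) :
    ∃ H : Finset (Fin M → ℂ), (∀ h ∈ H, h ∈ auxT g s p) ∧
      (∀ f ∈ auxT g s p, ∃ h ∈ H, ∀ y, ‖f y - h y‖ ≤ Lam / 2 ^ k) ∧
      Real.log H.card ≤ k * (65536 * A ^ 2 * B ^ 2 * s * Real.log (4 * M) *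
        Real.log (5 * N)) * (Lam / 2 ^ k) ^ (-p) := by
  induction k with
  | zero =>
    refine ⟨{hT.some}, ?_, ?_, ?_⟩
    · intro h hh
      rw [Finset.mem_singleton] at hh
      rw [hh]; exact hT.some_mem
    · intro f hf
      refine ⟨_, Finset.mem_singleton_self _, fun y => ?_⟩
      have h1 := hsup f hf y
      have h3 := hsup _ hT.some_mem y
      refine (norm_sub_le _ _).trans ?_
      simp
      linarith
    · simp
  | succ k ih =>
    obtain ⟨H, hH1, hH2, hH3⟩ := ih
    have hle : Lam / 2 ^ k ≤ Lam := div_le_self hlam.le (one_le_pow₀ (by norm_num))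
    obtain ⟨H', h1, h3, h4⟩ := aux_net_step hM hN g B A p hB hA hp hp2 hg s hs h2 (Lam / 2 ^ k)
      (by positivity) ((Real.rpow_le_rpow (by positivity) hle (by linarith)).trans hlamp) H hH1 hH2 hT
    have e : Lam / 2 ^ k / 2 = Lam / 2 ^ (k + 1) := by rw [pow_succ, div_div]
    rw [e] at h3
    refine ⟨H', h1, h3, h4.trans ?_⟩
    have hM' : (1 : ℝ) ≤ M := by exact_mod_cast hM
    have hN' : (1 : ℝ) ≤ N := by exact_mod_cast hN
    have hl1 : 0 ≤ Real.log (4 * M) := Real.log_nonneg (by linarith)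
    have hl2 : 0 ≤ Real.log (5 * N) := Real.log_nonneg (by linarith)
    set Y := 65536 * A ^ 2 * B ^ 2 * s * Real.log (4 * M) * Real.log (5 * N) with hY
    have hY0 : 0 ≤ Y := by positivity
    have hmono : (Lam / 2 ^ k) ^ (-p) ≤ (Lam / 2 ^ (k + 1)) ^ (-p) := by
      apply Real.rpow_le_rpow_of_nonpos (by positivity) _ (by linarith)
      rw [← e]; exact half_le_self (by positivity)
    calc Real.log H.card + Y * (Lam / 2 ^ k) ^ (-p) ≤
        k * Y * (Lam / 2 ^ k) ^ (-p) + Y * (Lam / 2 ^ k) ^ (-p) := by linarith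
      _ = ((k : ℝ) + 1) * Y * (Lam / 2 ^ k) ^ (-p) := by ring
      _ ≤ ((k : ℝ) + 1) * Y * (Lam / 2 ^ (k + 1)) ^ (-p) := by gcongr
      _ = _ := by push_cast; ring

lemma aux_layers_up (p a Lam : ℝ) (hp : 1 < p) (ha : 0 ≤ a) (hlam : 0 < Lam) (haL : a ≤ 4 * Lam)
    (e : ℕ → ℝ) (he : ∀ k, e k = 1 ∨ (e k = 0 ∧ a ≤ 4 * (Lam / 2 ^ k))) (K : ℕ) :
    a ^ p ≤ (4 * (Lam / 2 ^ K)) ^ p +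
      ∑ k ∈ Finset.range K, (8 * (Lam / 2 ^ (k + 1))) ^ p * e (k + 1) := by
  have he0 : ∀ k, 0 ≤ e k := by
    intro k; rcases he k with h | h
    · rw [h]; norm_num
    · rw [h.1]
  induction K with
  | zero => simpa using Real.rpow_le_rpow ha haL (by linarith)
  | succ K ih =>
    rw [Finset.sum_range_succ]
    have hs : 0 ≤ ∑ k ∈ Finset.range K, (8 * (Lam / 2 ^ (k + 1))) ^ p * e (k + 1) :=
      Finset.sum_nonneg fun k _ => mul_nonneg (by positivity) (he0 _)
    rcases he (K + 1) with h | h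
    · rw [h]
      have e1 : 8 * (Lam / 2 ^ (K + 1)) = 4 * (Lam / 2 ^ K) := by rw [pow_succ]; field_simp; norm_num
      rw [e1]
      have : 0 ≤ (4 * (Lam / 2 ^ (K + 1))) ^ p := by positivity
      linarith
    · rw [h.1]
      have := Real.rpow_le_rpow ha h.2 (show 0 ≤ p by linarith)
      linarith

lemma aux_layers_lo (p a Lam : ℝ) (hp : 1 < p) (hlam : 0 < Lam)
    (e : ℕ → ℝ) (he : ∀ k, e k = 0 ∨ (e k = 1 ∧ 2 * (Lam / 2 ^ k) ≤ a)) (K : ℕ) :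
    ∑ k ∈ Finset.range K, (Lam / 2 ^ (k + 1)) ^ p * e (k + 1) ≤
      max 0 (a ^ p - (Lam / 2 ^ K) ^ p) := by
  induction K with
  | zero => simp
  | succ K ih =>
    rw [Finset.sum_range_succ]
    set l := Lam / 2 ^ (K + 1) with hl
    have hl0 : 0 < l := by positivity
    have e1 : Lam / 2 ^ K = 2 * l := by rw [hl, pow_succ]; field_simp
    have h2 : 2 * l ^ p ≤ (2 * l) ^ p := by
      rw [Real.mul_rpow (by norm_num) hl0.le]
      gcongr
      nth_rewrite 1 [← Real.rpow_one 2]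
      exact Real.rpow_le_rpow_of_exponent_le (by norm_num) hp.le
    rw [e1] at ih
    have hlp : 0 < l ^ p := by positivity
    rcases he (K + 1) with h | h
    · rw [h, mul_zero, add_zero]
      refine ih.trans (max_le_max le_rfl ?_)
      linarith
    · rw [h.1, mul_one]
      refine le_trans ?_ (le_max_right _ _)
      have h3 : (2 * l) ^ p ≤ a ^ p := Real.rpow_le_rpow (by positivity) h.2 (by linarith)
      rcases max_choice 0 (a ^ p - (2 * l) ^ p) with hm | hm <;> rw [hm] at ih <;> linarith

lemma aux_step2 {M N : ℕ} (hM : 0 < M) (hN : 0 < N) (g : Fin N → Fin M → ℂ) (B A p : ℝ)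
    (hB : 1 ≤ B) (hA : 1 ≤ A) (hp : 1 < p) (hp2 : p ≤ 2) (hg : ∀ i y, ‖g i y‖ ≤ B) (s : ℕ)
    (hs : 0 < s)
    (h1 : ∀ (S : Finset (Fin N)) (c : Fin N → ℂ), S.card ≤ s → ∑ i ∈ S, ‖c i‖ ≤
      A * (s : ℝ) ^ (1 / p) * ((M : ℝ)⁻¹ * ∑ y, ‖auxF g S c y‖ ^ p) ^ (1 / p))
    (h2 : ∀ (S : Finset (Fin N)) (c : Fin N → ℂ), S.card ≤ 2 * s → ∑ i ∈ S, ‖c i‖ ≤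
      A * Real.sqrt (2 * s) * Real.sqrt ((M : ℝ)⁻¹ * ∑ y, ‖auxF g S c y‖ ^ (2 : ℝ)))
    (K m : ℕ) (hK : 0 < K) (hKL : 16 * B * A * s ≤ 2 ^ K) (hm0 : 0 < m)
    (hm : 1024 * (K : ℝ) ^ 2 * (65536 * A ^ 2 * B ^ 2 * s * Real.log (4 * M) *
        Real.log (5 * N)) ≤ m) :
    ∃ η : Fin m → Fin M, ∀ (S : Finset (Fin N)) (c : Fin N → ℂ), S.card ≤ s →
      (M : ℝ)⁻¹ * ∑ y, ‖auxF g S c y‖ ^ p ≤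
        512 * ((m : ℝ)⁻¹ * ∑ j, ‖auxF g S c (η j)‖ ^ p) := by
  have hs' : (1 : ℝ) ≤ s := by exact_mod_cast hs
  have hM' : (1 : ℝ) ≤ M := by exact_mod_cast hM
  have hN' : (1 : ℝ) ≤ N := by exact_mod_cast hN
  have hm' : (0 : ℝ) < m := by exact_mod_cast hm0
  have hK' : (1 : ℝ) ≤ K := by exact_mod_cast hK
  suffices hmain : ∃ η : Fin m → Fin M, ∀ f ∈ auxT g s p,
      1 ≤ 512 * ((m : ℝ)⁻¹ * ∑ j, ‖f (η j)‖ ^ p) by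
    obtain ⟨η, hη⟩ := hmain
    refine ⟨η, fun S c hS => ?_⟩
    have hsm : ∀ (r : ℝ) (c : Fin N → ℂ) (x : Fin M), 0 < r →
        ‖auxF g S (fun i => (r : ℂ) * c i) x‖ ^ p = r ^ p * ‖auxF g S c x‖ ^ p := by
      intro r c x hr
      rw [auxF_smul, norm_mul, Complex.norm_real, Real.norm_of_nonneg hr.le,
        Real.mul_rpow hr.le (norm_nonneg _)]
    refine aux_homog p 512 (by linarith) (fun c => (M : ℝ)⁻¹ * ∑ y, ‖auxF g S c y‖ ^ p)
      (fun c => (m : ℝ)⁻¹ * ∑ j, ‖auxF g S c (η j)‖ ^ p) (by norm_num)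
      (fun c => by positivity) (fun c => by positivity) ?_ ?_ ?_ c
    · intro r c hr
      simp only [hsm r c _ hr]
      rw [← Finset.mul_sum]; ring
    · intro r c hr
      simp only [hsm r c _ hr]
      rw [← Finset.mul_sum]; ring
    · intro c hc
      exact hη _ ⟨S, c, hS, rfl, hc⟩
  rcases (auxT g s p).eq_empty_or_nonempty with hT | hT
  · exact ⟨fun _ => ⟨0, hM⟩, fun f hf => by simp [hT] at hf⟩
  set Lam : ℝ := 2 * B * A * (s : ℝ) ^ (1 / p) with hLam
  have hL0 : 0 < Lam := by positivity
  have hAB : 1 ≤ A * B := by nlinarith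
  have hLp : Lam ^ p ≤ 4 * A ^ 2 * B ^ 2 * s := by
    rw [hLam, Real.mul_rpow (by positivity) (by positivity), ← Real.rpow_mul (by positivity),
      one_div_mul_cancel (by linarith), Real.rpow_one]
    gcongr
    calc (2 * B * A) ^ p ≤ (2 * B * A) ^ (2 : ℝ) :=
          Real.rpow_le_rpow_of_exponent_le (by nlinarith) hp2
      _ = _ := by rw [Real.rpow_two]; ring
  have hsup : ∀ f ∈ auxT g s p, ∀ y, ‖f y‖ ≤ Lam / 2 := by
    rintro f ⟨S, c, hS, hf, hf1⟩ y
    have e1 := h1 S c hS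
    rw [← hf, hf1, Real.one_rpow, mul_one] at e1
    rw [hf]
    refine (auxF_bdd hg S c y).trans ?_
    calc B * ∑ i ∈ S, ‖c i‖ ≤ B * (A * (s : ℝ) ^ (1 / p)) := by gcongr
      _ = Lam / 2 := by rw [hLam]; ring
  choose H hHT hHnet hHcard using
    aux_nets hM hN g B A p hB hA hp hp2 hg s hs h2 Lam hL0 hLp hT hsup
  have hlog4 : 1 ≤ Real.log (4 * M) := by
    rw [Real.le_log_iff_exp_le (by positivity)]
    have := Real.exp_one_lt_d9; linarith
  have hlog5 : 1 ≤ Real.log (5 * N) := by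
    rw [Real.le_log_iff_exp_le (by positivity)]
    have := Real.exp_one_lt_d9; linarith
  set Y : ℝ := 65536 * A ^ 2 * B ^ 2 * s * Real.log (4 * M) * Real.log (5 * N) with hY
  have hY0 : 0 < Y := by positivity
  have hYL : Lam ^ p ≤ Y := by
    refine hLp.trans ?_
    have : 1 ≤ Real.log (4 * M) * Real.log (5 * N) := by nlinarith
    calc 4 * A ^ 2 * B ^ 2 * s ≤ (65536 * A ^ 2 * B ^ 2 * s) * 1 := by
          have : 0 ≤ A ^ 2 * B ^ 2 * s := by positivity
          linarith
      _ ≤ (65536 * A ^ 2 * B ^ 2 * s) * (Real.log (4 * M) * Real.log (5 * N)) := by gcongr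
      _ = Y := by rw [hY]; ring
  set lam : ℕ → ℝ := fun k => Lam / 2 ^ k with hlam
  have hlam0 : ∀ k, 0 < lam k := fun k => by simp only [hlam]; positivity
  have hlamL : ∀ k, lam k ≤ Lam := fun k => div_le_self hL0.le (one_le_pow₀ (by norm_num))
  have hlamK : lam K ≤ 1 / 8 := by
    simp only [hlam]
    rw [div_le_iff₀ (by positivity)]
    have : (s : ℝ) ^ (1 / p) ≤ s := by
      nth_rewrite 2 [← Real.rpow_one (s : ℝ)]
      exact Real.rpow_le_rpow_of_exponent_le hs' ((div_le_one (by linarith)).mpr hp.le)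
    have h3 : Lam ≤ 2 * B * A * s := by rw [hLam]; gcongr
    linarith
  let I := Σ k : Fin K, (H ((k : ℕ) + 1))
  set φ : I → Fin M → ℝ := fun i y => if 3 * lam ((i.1 : ℕ) + 1) ≤ ‖i.2.1 y‖ then 1 else 0 with hφ
  set L : I → ℝ := fun i => Real.log K + ((i.1 : ℕ) + 1 : ℕ) * Y * lam ((i.1 : ℕ) + 1) ^ (-p) with hL
  obtain ⟨η, hη⟩ := aux_select φ (fun _ => 1) (fun i => (M : ℝ)⁻¹ * ∑ y, φ i y) L
    (fun _ => one_pos) (fun i y => by simp only [hφ]; split_ifs <;> norm_num)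
    (fun i y => by simp only [hφ]; split_ifs <;> norm_num) (by
      intro a ha
      by_contra hcon
      push Not at hcon
      have e1 : ∑ y : Fin M, ∑ i, a i * φ i y < ∑ y : Fin M, ∑ i, a i * ((M : ℝ)⁻¹ * ∑ y, φ i y) :=
        Finset.sum_lt_sum_of_nonempty ⟨⟨0, hM⟩, Finset.mem_univ _⟩ fun y _ => hcon y
      rw [Finset.sum_const, Finset.card_univ, Fintype.card_fin, nsmul_eq_mul, Finset.mul_sum,
        Finset.sum_comm] at e1
      refine absurd e1 (not_lt.mpr (le_of_eq ?_))
      refine Finset.sum_congr rfl fun i _ => ?_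
      rw [← Finset.mul_sum]
      field_simp) (by
      rw [Fintype.sum_sigma]
      have e1 : ∀ k : Fin K, ∑ h : H ((k : ℕ) + 1), Real.exp (-L ⟨k, h⟩) ≤ 1 / K := by
        intro k
        simp only [hL]
        rw [Finset.sum_const, Finset.card_univ, Fintype.card_coe, nsmul_eq_mul, neg_add,
          Real.exp_add, Real.exp_neg, Real.exp_log (by linarith), mul_left_comm, one_div]
        have e2 := hHcard ((k : ℕ) + 1)
        have e3 : 0 < (H ((k : ℕ) + 1)).card := by
          obtain ⟨h, hh, -⟩ := hHnet ((k : ℕ) + 1) _ hT.some_mem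
          exact Finset.card_pos.mpr ⟨h, hh⟩
        have e4 : ((H ((k : ℕ) + 1)).card : ℝ) ≤
            Real.exp (((k : ℕ) + 1 : ℕ) * Y * lam ((k : ℕ) + 1) ^ (-p)) := by
          rw [← Real.log_le_iff_le_exp (by exact_mod_cast e3)]
          exact e2
        have e5 : ((H ((k : ℕ) + 1)).card : ℝ) *
            Real.exp (-(((k : ℕ) + 1 : ℕ) * Y * lam ((k : ℕ) + 1) ^ (-p))) ≤ 1 := by
          rw [Real.exp_neg, ← div_eq_mul_inv]
          exact (div_le_one (Real.exp_pos _)).mpr e4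
        exact mul_le_of_le_one_right (by positivity) e5
      refine (Finset.sum_le_sum fun k _ => e1 k).trans (le_of_eq ?_)
      rw [Finset.sum_const, Finset.card_univ, Fintype.card_fin, nsmul_eq_mul]
      field_simp) m
  refine ⟨η, fun f hf => ?_⟩
  choose h hhH hfh using fun k => hHnet k f hf
  set e : ℕ → Fin M → ℝ := fun k y => if 3 * lam k ≤ ‖h k y‖ then 1 else 0 with he
  have heφ : ∀ k : Fin K, φ ⟨k, ⟨h ((k : ℕ) + 1), hhH _⟩⟩ = e ((k : ℕ) + 1) := by
    intro k; rfl
  have hup : ∀ y, ‖f y‖ ^ p ≤ (4 * lam K) ^ p +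
      ∑ k ∈ Finset.range K, (8 * lam (k + 1)) ^ p * e (k + 1) y := by
    intro y
    refine aux_layers_up p ‖f y‖ Lam hp (norm_nonneg _) hL0 (by linarith [hsup f hf y])
      (fun k => e k y) (fun k => ?_) K
    simp only [he]
    split_ifs with hk
    · exact Or.inl rfl
    · refine Or.inr ⟨rfl, ?_⟩
      push Not at hk
      have := norm_le_norm_add_norm_sub' (f y) (h k y)
      have h3 := hfh k y
      simp only [hlam] at hk
      linarith
  have hlo : ∀ y, ∑ k ∈ Finset.range K, lam (k + 1) ^ p * e (k + 1) y ≤ ‖f y‖ ^ p := by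
    intro y
    refine (aux_layers_lo p ‖f y‖ Lam hp hL0 (fun k => e k y) (fun k => ?_) K).trans ?_
    · simp only [he]
      split_ifs with hk
      · refine Or.inr ⟨rfl, ?_⟩
        have := norm_le_norm_add_norm_sub (f y) (h k y)
        have h3 := hfh k y
        simp only [hlam] at hk
        linarith
      · exact Or.inl rfl
    · apply max_le (by positivity)
      have : 0 ≤ (Lam / 2 ^ K) ^ p := by positivity
      linarith
  obtain ⟨S, c, hS, hfS, hf1⟩ := hf
  set a : ℕ → ℝ := fun k => (M : ℝ)⁻¹ * ∑ y, e k y with ha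
  have ha0 : ∀ k, 0 ≤ a k := by
    intro k; simp only [ha]
    refine mul_nonneg (by positivity) (Finset.sum_nonneg fun y _ => ?_)
    simp only [he]; split_ifs <;> norm_num
  have hlow : (1 / 128 : ℝ) ≤ ∑ k ∈ Finset.range K, lam (k + 1) ^ p * a (k + 1) := by
    have e1 : (1 : ℝ) ≤ (4 * lam K) ^ p +
        ∑ k ∈ Finset.range K, (8 * lam (k + 1)) ^ p * a (k + 1) := by
      calc (1 : ℝ) = (M : ℝ)⁻¹ * ∑ y, ‖f y‖ ^ p := hf1.symm
        _ ≤ (M : ℝ)⁻¹ * ∑ y, ((4 * lam K) ^ p +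
              ∑ k ∈ Finset.range K, (8 * lam (k + 1)) ^ p * e (k + 1) y) := by
            gcongr with y; exact hup y
        _ = _ := by
            rw [Finset.sum_add_distrib, mul_add, Finset.sum_comm]
            congr 1
            · simp; field_simp
            · rw [Finset.mul_sum]
              refine Finset.sum_congr rfl fun k _ => ?_
              rw [← Finset.mul_sum]; simp only [ha]; ring
    have e2 : (4 * lam K) ^ p ≤ 1 / 2 := by
      calc (4 * lam K) ^ p ≤ (1 / 2 : ℝ) ^ p :=
            Real.rpow_le_rpow (by have := hlam0 K; positivity) (by linarith) (by linarith)
        _ ≤ (1 / 2 : ℝ) ^ (1 : ℝ) :=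
            Real.rpow_le_rpow_of_exponent_ge (by norm_num) (by norm_num) hp.le
        _ = 1 / 2 := Real.rpow_one _
    have e3 : ∑ k ∈ Finset.range K, (8 * lam (k + 1)) ^ p * a (k + 1) ≤
        64 * ∑ k ∈ Finset.range K, lam (k + 1) ^ p * a (k + 1) := by
      rw [Finset.mul_sum]
      refine Finset.sum_le_sum fun k _ => ?_
      rw [Real.mul_rpow (by norm_num) (hlam0 _).le]
      have e4 : (8 : ℝ) ^ p ≤ 64 := by
        calc (8 : ℝ) ^ p ≤ (8 : ℝ) ^ (2 : ℝ) :=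
              Real.rpow_le_rpow_of_exponent_le (by norm_num) hp2
          _ = 64 := by rw [Real.rpow_two]; norm_num
      have e5 : 0 ≤ lam (k + 1) ^ p * a (k + 1) :=
        mul_nonneg (Real.rpow_nonneg (hlam0 _).le _) (ha0 _)
      rw [mul_assoc]
      exact mul_le_mul_of_nonneg_right e4 e5
    linarith
  have hsel : ∀ k ∈ Finset.range K, lam (k + 1) ^ p * a (k + 1) * (m / 2) - 2 * K * Y ≤
      ∑ j, lam (k + 1) ^ p * e (k + 1) (η j) := by
    intro k hk
    rw [Finset.mem_range] at hk
    have e1 := hη ⟨⟨k, hk⟩, ⟨h (k + 1), hhH _⟩⟩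
    have e2 : φ ⟨⟨k, hk⟩, ⟨h (k + 1), hhH _⟩⟩ = e (k + 1) := rfl
    have e3 : L ⟨⟨k, hk⟩, ⟨h (k + 1), hhH _⟩⟩ =
      Real.log K + ((k + 1 : ℕ) : ℝ) * Y * lam (k + 1) ^ (-p) := rfl
    rw [e2, e3, one_mul] at e1
    rw [← Finset.mul_sum]
    have hlp : 0 < lam (k + 1) ^ p := Real.rpow_pos_of_pos (hlam0 _) _
    have e4 := mul_le_mul_of_nonneg_left e1 hlp.le
    refine le_trans ?_ e4
    have hinv : lam (k + 1) ^ p * lam (k + 1) ^ (-p) = 1 := by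
      rw [← Real.rpow_add (hlam0 _)]; simp
    have e6 : lam (k + 1) ^ p * (m * (((M : ℝ)⁻¹ * ∑ y, e (k + 1) y) / 2)) =
      lam (k + 1) ^ p * a (k + 1) * (m / 2) := by simp only [ha]; ring
    have e7 : lam (k + 1) ^ p * Real.log K ≤ Y * K := by
      have : lam (k + 1) ^ p ≤ Y :=
        (Real.rpow_le_rpow (hlam0 _).le (hlamL _) (by linarith)).trans hYL
      have h3 : Real.log K ≤ K := (Real.log_le_sub_one_of_pos (by linarith)).trans (by linarith)
      have h4 : 0 ≤ Real.log K := Real.log_nonneg hK'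
      exact mul_le_mul this h3 h4 hY0.le
    have e8 : lam (k + 1) ^ p * (((k + 1 : ℕ) : ℝ) * Y * lam (k + 1) ^ (-p)) ≤ K * Y := by
      have : lam (k + 1) ^ p * (((k + 1 : ℕ) : ℝ) * Y * lam (k + 1) ^ (-p)) =
        ((k + 1 : ℕ) : ℝ) * Y * (lam (k + 1) ^ p * lam (k + 1) ^ (-p)) := by ring
      rw [this, hinv, mul_one]
      have : ((k + 1 : ℕ) : ℝ) ≤ K := by exact_mod_cast hk
      gcongr
    have e10 : lam (k + 1) ^ p * (↑m * (((M : ℝ)⁻¹ * ∑ y, e (k + 1) y) / 2) -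
        (Real.log K + ((k + 1 : ℕ) : ℝ) * Y * lam (k + 1) ^ (-p))) =
        lam (k + 1) ^ p * (m * (((M : ℝ)⁻¹ * ∑ y, e (k + 1) y) / 2)) -
        lam (k + 1) ^ p * Real.log K -
        lam (k + 1) ^ p * (((k + 1 : ℕ) : ℝ) * Y * lam (k + 1) ^ (-p)) := by ring
    rw [e10, e6]
    linarith
  have hsum := Finset.sum_le_sum hsel
  rw [Finset.sum_comm, Finset.sum_sub_distrib, ← Finset.sum_mul, Finset.sum_const,
    Finset.card_range, nsmul_eq_mul] at hsum
  have hfin : ∑ j, ∑ k ∈ Finset.range K, lam (k + 1) ^ p * e (k + 1) (η j) ≤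
      ∑ j, ‖f (η j)‖ ^ p := Finset.sum_le_sum fun j _ => hlo (η j)
  have h3 : (1 / 128 : ℝ) * (m / 2) ≤
      (∑ k ∈ Finset.range K, lam (k + 1) ^ p * a (k + 1)) * (m / 2) := by gcongr
  have h4 : (K : ℝ) * (2 * K * Y) ≤ m / 512 := by nlinarith
  rw [mul_left_comm, ← div_eq_inv_mul, le_div_iff₀ hm']
  linarith


lemma aux_rpow_le (C x q : ℝ) (hC : 1 ≤ C) (hx : 0 ≤ x) (hq : 1 < q) :
    (C * x) ^ (1 / q) ≤ C * x ^ (1 / q) := by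
  rw [Real.mul_rpow (by linarith) hx]
  refine mul_le_mul_of_nonneg_right ?_ (by positivity)
  calc C ^ (1 / q) ≤ C ^ (1 : ℝ) := by
        refine Real.rpow_le_rpow_of_exponent_le hC ?_
        rw [div_le_one (by linarith)]; linarith
    _ = C := Real.rpow_one C

lemma AuxONS.disc {X : Type*} [MeasurableSpace X] {μ : Measure X} [IsProbabilityMeasure μ] {N : ℕ}
    {g : Fin N → X → ℂ} {B : ℝ} (h : AuxONS μ g B) (p : ℝ) (hp : 1 < p) (hp2 : p ≤ 2) (hN : 0 < N)
    (s M : ℕ) (hs : 0 < s) (hM0 : 0 < M) (hM : 1024 * ((2 * s : ℕ) : ℝ) ^ 2 * B ^ 4 *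
      (Real.log 2 + ((2 * s : ℕ) : ℝ) *
      Real.log (N * (2 * (128 * ((2 * s : ℕ) : ℝ) * B ^ 2 + 1) + 1) ^ 2)) ≤ M)
    (K m : ℕ) (hK : 0 < K) (hKL : 16 * B * (32 * B) * s ≤ 2 ^ K) (hm0 : 0 < m)
    (hm : 1024 * (K : ℝ) ^ 2 * (65536 * (32 * B) ^ 2 * B ^ 2 * s * Real.log (4 * M) *
        Real.log (5 * N)) ≤ m) :
    ∃ ξ : Fin m → X, ∀ (S : Finset (Fin N)) (c : Fin N → ℂ), S.card ≤ s →
      ∫ x, ‖auxF g S c x‖ ^ p ∂μ ≤ 16384 * ((m : ℝ)⁻¹ * ∑ j, ‖auxF g S c (ξ j)‖ ^ p) := by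
  obtain ⟨ξ, hξ⟩ := h.step1 p hp hp2 hN (2 * s) M (by omega) hM0 hM
  have hB := h.one_le
  have key : ∀ q : ℝ, (q = p ∨ q = 2) → ∀ (r : ℕ), r ≤ 2 * s → ∀ (S : Finset (Fin N)) (c : Fin N → ℂ),
      S.card ≤ r → ∑ i ∈ S, ‖c i‖ ≤ 32 * B * (r : ℝ) ^ (1 / q) *
        ((M : ℝ)⁻¹ * ∑ y, ‖auxF g S c (ξ y)‖ ^ q) ^ (1 / q) := by
    intro q hq r hr S c hS
    have hq1 : 1 < q := by rcases hq with rfl | rfl <;> linarith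
    have hq2 : q ≤ 2 := by rcases hq with rfl | rfl <;> linarith
    refine (h.inc q hq1 hq2 S S (Finset.Subset.refl _) c).trans ?_
    have e1 : (∫ x, ‖auxF g S c x‖ ^ q ∂μ) ^ (1 / q) ≤
        32 * ((M : ℝ)⁻¹ * ∑ y, ‖auxF g S c (ξ y)‖ ^ q) ^ (1 / q) := by
      refine le_trans ?_ (aux_rpow_le 32 _ q (by norm_num) (by positivity) hq1)
      exact Real.rpow_le_rpow (integral_nonneg fun x => by positivity)
        (hξ q hq S (hS.trans hr) c) (by positivity)
    have e2 : (S.card : ℝ) ^ (1 / q) ≤ (r : ℝ) ^ (1 / q) :=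
      Real.rpow_le_rpow (by positivity) (by exact_mod_cast hS) (by positivity)
    have e3 : B * (S.card : ℝ) ^ (1 / q) * (∫ x, ‖auxF g S c x‖ ^ q ∂μ) ^ (1 / q) ≤
        B * (r : ℝ) ^ (1 / q) * (32 * ((M : ℝ)⁻¹ * ∑ y, ‖auxF g S c (ξ y)‖ ^ q) ^ (1 / q)) := by
      gcongr
    linarith
  obtain ⟨η, hη⟩ := aux_step2 hM0 hN (fun i y => g i (ξ y)) B (32 * B) p hB (by linarith) hp hp2
    (fun i y => h.bdd i _) s hs (fun S c hS => key p (Or.inl rfl) s (by omega) S c hS)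
    (fun S c hS => by
      have := key 2 (Or.inr rfl) (2 * s) le_rfl S c hS
      rw [Real.sqrt_eq_rpow, Real.sqrt_eq_rpow]
      push_cast at this
      exact this) K m hK hKL hm0 hm
  refine ⟨fun j => ξ (η j), fun S c hS => ?_⟩
  have e1 := hξ p (Or.inl rfl) S (by omega) c
  have e2 : (M : ℝ)⁻¹ * ∑ y, ‖auxF g S c (ξ y)‖ ^ p ≤
        512 * ((m : ℝ)⁻¹ * ∑ j, ‖auxF g S c (ξ (η j))‖ ^ p) := hη S c hS
  linarith

set_option maxHeartbeats 1000000 in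
/-- Parameters. -/
lemma aux_params (b : ℝ) (hb : 1 ≤ b) (u v N : ℕ) (hv : 0 < v) (hvu : v ≤ u) (huN : u ≤ N)
    (hbu : 262144 * b ^ 2 ≤ u) :
    ∃ M K m : ℕ, 0 < M ∧ 0 < K ∧ 0 < m ∧
      1024 * ((2 * (u + v) : ℕ) : ℝ) ^ 2 * b ^ 4 *
      (Real.log 2 + ((2 * (u + v) : ℕ) : ℝ) *
      Real.log (N * (2 * (128 * ((2 * (u + v) : ℕ) : ℝ) * b ^ 2 + 1) + 1) ^ 2)) ≤ M ∧
      16 * b * (32 * b) * ((u + v : ℕ) : ℝ) ≤ 2 ^ K ∧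
      1024 * (K : ℝ) ^ 2 * (65536 * (32 * b) ^ 2 * b ^ 2 * ((u + v : ℕ) : ℝ) * Real.log (4 * M) *
        Real.log (5 * N)) ≤ m ∧
      (m : ℝ) ≤ (2 * (1024 * 49 * 65536 * 1024 * 28) * b ^ 4) * u * Real.log N *
        (Real.log (2 * (u : ℝ))) ^ 2 * (Real.log (2 * (u : ℝ)) + Real.log (Real.log N)) := by
  have hb2 : 1 ≤ b ^ 2 := one_le_pow₀ hb
  have hu : (262144 : ℝ) ≤ u := by nlinarith
  have hN : (u : ℝ) ≤ N := by exact_mod_cast huN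
  have hvu' : (v : ℝ) ≤ u := by exact_mod_cast hvu
  have hu0 : (0 : ℝ) < u := by linarith
  have hN0 : (0 : ℝ) < N := by linarith
  have hbu' : b ^ 2 ≤ u := by nlinarith
  have hlogN : 1 ≤ Real.log N := by
    rw [Real.le_log_iff_exp_le hN0]
    have := Real.exp_one_lt_d9
    linarith
  have hU : 1 ≤ Real.log (2 * (u : ℝ)) := by
    rw [Real.le_log_iff_exp_le (by linarith)]
    have := Real.exp_one_lt_d9
    linarith
  have hLL : 0 ≤ Real.log (Real.log N) := Real.log_nonneg hlogN
  set LN := Real.log N with hLN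
  set U := Real.log (2 * (u : ℝ)) with hUd
  set LL := Real.log LN with hLLd
  set s : ℝ := ((u + v : ℕ) : ℝ) with hs
  have hs2 : s ≤ 2 * u := by rw [hs]; push_cast; linarith
  have hs0 : 0 < s := by rw [hs]; push_cast; positivity
  have hss : ((2 * (u + v) : ℕ) : ℝ) = 2 * s := by rw [hs]; push_cast; ring
  rw [hss]
  set Q : ℝ := (u : ℝ) ^ 7 * LN with hQ
  have hQ1 : 1 ≤ Q := by
    have : (1 : ℝ) ≤ (u : ℝ) ^ 7 := one_le_pow₀ (by linarith)
    nlinarith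
  have hM1 : Q ≤ (⌈Q⌉₊ : ℝ) := Nat.le_ceil _
  have hM2 : (⌈Q⌉₊ : ℝ) ≤ 2 * Q := by
    have := (Nat.ceil_lt_add_one (by linarith : 0 ≤ Q)).le
    linarith
  have hK1 : 6 * U ≤ (⌈6 * U⌉₊ : ℝ) := Nat.le_ceil _
  have hK2 : (⌈6 * U⌉₊ : ℝ) ≤ 7 * U := by
    have := (Nat.ceil_lt_add_one (by linarith : 0 ≤ 6 * U)).le
    linarith
  set Z : ℝ := (1024 * 49 * 65536 * 1024 * 28) * b ^ 4 * u * LN * U ^ 2 * (U + LL) with hZ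
  have hb4 : 1 ≤ b ^ 4 := one_le_pow₀ hb
  have hZ1 : 1 ≤ Z := by
    have h1 : 1 ≤ U ^ 2 := one_le_pow₀ hU
    have h2 : 1 ≤ (1024 * 49 * 65536 * 1024 * 28) * b ^ 4 := by linarith
    have h3 := one_le_mul_of_one_le_of_one_le h2 (by linarith : (1 : ℝ) ≤ u)
    have h4 := one_le_mul_of_one_le_of_one_le h3 hlogN
    have h5 := one_le_mul_of_one_le_of_one_le h4 h1
    exact one_le_mul_of_one_le_of_one_le h5 (by linarith)
  refine ⟨⌈Q⌉₊, ⌈6 * U⌉₊, ⌈Z⌉₊, Nat.ceil_pos.mpr (by linarith), Nat.ceil_pos.mpr (by linarith),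
    Nat.ceil_pos.mpr (by linarith), ?_, ?_, ?_, ?_⟩
  · refine le_trans ?_ hM1
    have e1 : (2 * (128 * (2 * s) * b ^ 2 + 1) + 1) ≤ (u : ℝ) ^ 4 := by
      have h1 : s * b ^ 2 ≤ 2 * u * u := by gcongr
      have h2 : (262144 : ℝ) ^ 2 ≤ (u : ℝ) ^ 2 := by gcongr
      have h3 : (262144 : ℝ) ^ 2 * (u : ℝ) ^ 2 ≤ (u : ℝ) ^ 2 * (u : ℝ) ^ 2 := by gcongr
      nlinarith
    have e2 : Real.log (N * (2 * (128 * (2 * s) * b ^ 2 + 1) + 1) ^ 2) ≤ 9 * LN := by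
      calc Real.log (N * (2 * (128 * (2 * s) * b ^ 2 + 1) + 1) ^ 2) ≤
          Real.log (N * ((N : ℝ) ^ 4) ^ 2) := by
            apply Real.log_le_log (by positivity)
            gcongr
            exact e1.trans (by gcongr)
        _ = Real.log ((N : ℝ) ^ 9) := by congr 1; ring
        _ = 9 * LN := by rw [Real.log_pow]; push_cast; rfl
    have e3 : Real.log 2 ≤ LN := Real.log_le_log (by norm_num) (by linarith)
    have e4 : Real.log 2 + 2 * s * Real.log (N * (2 * (128 * (2 * s) * b ^ 2 + 1) + 1) ^ 2) ≤
        37 * u * LN := by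
      have : 2 * s * Real.log (N * (2 * (128 * (2 * s) * b ^ 2 + 1) + 1) ^ 2) ≤
        2 * (2 * u) * (9 * LN) := by
        refine mul_le_mul (by linarith) e2 ?_ (by positivity)
        apply Real.log_nonneg
        have : (1 : ℝ) ≤ (2 * (128 * (2 * s) * b ^ 2 + 1) + 1) ^ 2 := by
          apply one_le_pow₀
          have : 0 ≤ 128 * (2 * s) * b ^ 2 := by positivity
          linarith
        exact one_le_mul_of_one_le_of_one_le (by linarith) this
      nlinarith
    have e5 : 1024 * (2 * s) ^ 2 * b ^ 4 ≤ 16384 * (u : ℝ) ^ 4 := by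
      have h1 : (2 * s) ^ 2 ≤ (4 * u) ^ 2 := by
        apply pow_le_pow_left₀ (by positivity); linarith
      have h2 : b ^ 4 ≤ (u : ℝ) ^ 2 := by
        have : b ^ 4 = (b ^ 2) ^ 2 := by ring
        rw [this]; gcongr
      calc 1024 * (2 * s) ^ 2 * b ^ 4 ≤ 1024 * (4 * u) ^ 2 * (u : ℝ) ^ 2 := by gcongr
        _ = _ := by ring
    calc _ ≤ 16384 * (u : ℝ) ^ 4 * (37 * u * LN) := by
          refine mul_le_mul e5 e4 ?_ (by positivity)
          have h2 := Real.log_nonneg (by norm_num : (1 : ℝ) ≤ 2)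
          have : 0 ≤ Real.log (N * (2 * (128 * (2 * s) * b ^ 2 + 1) + 1) ^ 2) := by
            apply Real.log_nonneg
            have : (1 : ℝ) ≤ (2 * (128 * (2 * s) * b ^ 2 + 1) + 1) ^ 2 := by
              apply one_le_pow₀
              have : 0 ≤ 128 * (2 * s) * b ^ 2 := by positivity
              linarith
            exact one_le_mul_of_one_le_of_one_le (by linarith) this
          positivity
      _ = 606208 * ((u : ℝ) ^ 5 * LN) := by ring
      _ ≤ (u : ℝ) ^ 2 * ((u : ℝ) ^ 5 * LN) := by
          refine mul_le_mul_of_nonneg_right ?_ (by positivity)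
          nlinarith
      _ = Q := by rw [hQ]; ring
  · have h1 : 16 * b * (32 * b) * s ≤ 1024 * (u : ℝ) ^ 2 := by
      have : s * b ^ 2 ≤ 2 * u * u := by gcongr
      nlinarith
    refine h1.trans ?_
    rw [← Real.rpow_natCast 2]
    have h2 : (2 : ℝ) ^ (6 * U) ≤ (2 : ℝ) ^ ((⌈6 * U⌉₊ : ℕ) : ℝ) :=
      Real.rpow_le_rpow_of_exponent_le (by norm_num) hK1
    refine le_trans ?_ h2
    have h3 : (2 * (u : ℝ)) ^ 4 ≤ (2 : ℝ) ^ (6 * U) := by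
      rw [Real.rpow_def_of_pos (by norm_num), ← Real.exp_log (by positivity : 0 < (2 * (u : ℝ)) ^ 4),
        Real.log_pow]
      apply Real.exp_le_exp.mpr
      have := Real.log_two_gt_d9
      push_cast
      rw [← hUd]
      nlinarith
    refine le_trans ?_ h3
    have : (1024 : ℝ) ≤ u ^ 2 := by nlinarith
    have h5 : (2 * (u : ℝ)) ^ 4 = 16 * (u : ℝ) ^ 2 * (u : ℝ) ^ 2 := by ring
    rw [h5]
    refine mul_le_mul_of_nonneg_right ?_ (by positivity)
    linarith
  · refine le_trans ?_ (Nat.le_ceil Z)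
    have hMp : (0 : ℝ) < (⌈Q⌉₊ : ℝ) := by linarith
    have e1 : Real.log (4 * (⌈Q⌉₊ : ℝ)) ≤ 7 * (U + LL) := by
      have h1 : 4 * (⌈Q⌉₊ : ℝ) ≤ (2 * (u : ℝ)) ^ 7 * LN := by
        have : (2 * (u : ℝ)) ^ 7 * LN = 128 * Q := by rw [hQ]; ring
        rw [this]; linarith
      calc Real.log (4 * (⌈Q⌉₊ : ℝ)) ≤ Real.log ((2 * (u : ℝ)) ^ 7 * LN) :=
            Real.log_le_log (by linarith) h1
        _ = 7 * U + LL := by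
            rw [Real.log_mul (by positivity) (by positivity), Real.log_pow]; push_cast; rfl
        _ ≤ _ := by linarith
    have e2 : Real.log (5 * (N : ℝ)) ≤ 2 * LN := by
      calc Real.log (5 * (N : ℝ)) ≤ Real.log ((N : ℝ) ^ 2) :=
            Real.log_le_log (by positivity) (by nlinarith)
        _ = 2 * LN := by rw [Real.log_pow]; push_cast; rfl
    have e3 : 0 ≤ Real.log (4 * (⌈Q⌉₊ : ℝ)) := Real.log_nonneg (by linarith)
    have e4 : 0 ≤ Real.log (5 * (N : ℝ)) := Real.log_nonneg (by linarith)
    calc 1024 * (⌈6 * U⌉₊ : ℝ) ^ 2 * (65536 * (32 * b) ^ 2 * b ^ 2 * s *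
          Real.log (4 * (⌈Q⌉₊ : ℝ)) * Real.log (5 * N)) ≤
        1024 * (7 * U) ^ 2 * (65536 * (32 * b) ^ 2 * b ^ 2 * (2 * u) *
          (7 * (U + LL)) * (2 * LN)) := by gcongr
      _ = Z := by rw [hZ]; ring
  · have := (Nat.ceil_lt_add_one (by linarith : 0 ≤ Z)).le
    have e : (2 * (1024 * 49 * 65536 * 1024 * 28) * b ^ 4) * u * LN * U ^ 2 * (U + LL) = 2 * Z := by
      rw [hZ]; ring
    rw [e]; linarith

/-- The constant `c`. -/
def auxC (t p : ℝ) : ℝ := max 1 (2 ^ (p / (p - 1)) * (t ^ (-(p / (p - 1))) + 1))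

lemma aux_u (b p t : ℝ) (hb : 1 ≤ b) (hp : 1 < p) (hp2 : p ≤ 2) (ht : 0 < t) (v : ℕ)
    (hv : 0 < v) :
    v ≤ uONS (auxC t p) (131072 * b ^ 2) p v ∧
    262144 * b ^ 2 ≤ (uONS (auxC t p) (131072 * b ^ 2) p v : ℝ) ∧
    2 * (Real.log (2 * (131072 * b ^ 2) * v) / (t / (4 * (16384 * b)) / 4 *
      (t / (4 * (16384 * b)) / (4 * b ^ p)) ^ (1 / (p - 1))) + 1)
      * 2 ^ (1 / (p - 1)) * (v : ℝ) ^ (1 / (p - 1)) ≤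
      (uONS (auxC t p) (131072 * b ^ 2) p v : ℝ) := by
  have hb2 : 1 ≤ b ^ 2 := one_le_pow₀ hb
  have hv1 : (1 : ℝ) ≤ v := by exact_mod_cast hv
  have hp1 : 0 < p - 1 := by linarith
  set a := 1 / (p - 1) with ha
  have ha1 : 1 ≤ a := by rw [ha, le_div_iff₀ hp1]; linarith
  have hpa : p / (p - 1) = 1 + a := by rw [ha]; field_simp; ring
  set W := 131072 * b ^ 2 with hW
  have hW1 : 131072 ≤ W := by rw [hW]; linarith
  set L := Real.log (2 * W * v) with hL
  have hL1 : 1 ≤ L := by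
    have : 262144 ≤ 2 * W * v := by nlinarith
    rw [hL, Real.le_log_iff_exp_le (by linarith)]
    have := Real.exp_one_lt_d9
    linarith
  set C := auxC t p with hC
  have hC1 : 1 ≤ C := le_max_left _ _
  have hC2 : 2 ^ (1 + a) * (t ^ (-(1 + a)) + 1) ≤ C := by
    rw [hC]; unfold auxC; rw [hpa]; exact le_max_right _ _
  have hva : (v : ℝ) ≤ (v : ℝ) ^ a := by
    calc (v : ℝ) = (v : ℝ) ^ (1 : ℝ) := (Real.rpow_one _).symm
      _ ≤ _ := Real.rpow_le_rpow_of_exponent_le hv1 ha1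
  have hva1 : 1 ≤ (v : ℝ) ^ a := hv1.trans hva
  have hR : 2 * W ≤ (2 * W) ^ (1 + a) := by
    calc 2 * W = (2 * W) ^ (1 : ℝ) := (Real.rpow_one _).symm
      _ ≤ _ := Real.rpow_le_rpow_of_exponent_le (by linarith) (by linarith)
  set R := (2 * W) ^ (1 + a) with hRd
  have hR0 : 0 < R := by linarith
  have hu : (1 + C * R * L) * (v : ℝ) ^ a ≤ (uONS C W p v : ℝ) := by
    unfold uONS; rw [hpa]; exact Nat.le_ceil _
  have hRL : R ≤ R * L := le_mul_of_one_le_right hR0.le hL1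
  have hCRL : R * L ≤ C * R * L := by
    rw [mul_assoc]; exact le_mul_of_one_le_left (by positivity) hC1
  refine ⟨?_, ?_, ?_⟩
  · have : (v : ℝ) ≤ (uONS C W p v : ℝ) := by
      refine le_trans ?_ hu
      refine hva.trans (le_mul_of_one_le_left (by linarith) ?_)
      linarith
    exact_mod_cast this
  · refine le_trans ?_ hu
    have h1 : 262144 * b ^ 2 = 2 * W := by rw [hW]; ring
    rw [h1]
    have : 2 * W ≤ 1 + C * R * L := by linarith
    exact this.trans (le_mul_of_one_le_right (by linarith) hva1)
  · refine le_trans ?_ hu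
    have hδ : t / (4 * (16384 * b)) / 4 * (t / (4 * (16384 * b)) / (4 * b ^ p)) ^ a =
        (t / (2 * W)) ^ (1 + a) := by
      set r := t / (2 * W) with hr
      have hr0 : 0 < r := by positivity
      have h1 : t / (4 * (16384 * b)) / 4 = b * r := by rw [hr, hW]; field_simp; norm_num
      have h2 : t / (4 * (16384 * b)) / (4 * b ^ p) = r * b ^ (1 - p) := by
        rw [Real.rpow_sub (by linarith), Real.rpow_one, hr, hW]; field_simp; norm_num
      rw [h1, h2, Real.mul_rpow hr0.le (by positivity), ← Real.rpow_mul (by linarith),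
        Real.rpow_add hr0, Real.rpow_one]
      have : (1 - p) * a = -1 := by rw [ha]; field_simp; ring
      rw [this, Real.rpow_neg_one]
      field_simp
    rw [hδ, Real.div_rpow ht.le (by linarith), ← hRd]
    have h3 : L / (t ^ (1 + a) / R) = t ^ (-(1 + a)) * (R * L) := by
      rw [Real.rpow_neg ht.le]; field_simp
    rw [h3]
    refine mul_le_mul_of_nonneg_right ?_ (by linarith)
    have h4 : 2 * (t ^ (-(1 + a)) * (R * L) + 1) * 2 ^ a =
      2 ^ (1 + a) * (t ^ (-(1 + a)) * (R * L) + 1) := by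
      rw [Real.rpow_add (by norm_num), Real.rpow_one]; ring
    rw [h4]
    have h5 : (2 : ℝ) ^ (1 + a) * (t ^ (-(1 + a)) * (R * L) + 1) ≤
        2 ^ (1 + a) * (t ^ (-(1 + a)) + 1) * (R * L) := by
      have : (1 : ℝ) ≤ R * L := by linarith
      have h6 : t ^ (-(1 + a)) * (R * L) + 1 ≤ (t ^ (-(1 + a)) + 1) * (R * L) := by linarith
      rw [mul_assoc]
      gcongr
    have h7 : 2 ^ (1 + a) * (t ^ (-(1 + a)) + 1) * (R * L) ≤ C * (R * L) := by gcongr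
    linarith


lemma aux_sample {X : Type*} [MeasurableSpace X] [MeasurableSingletonClass X] {μ : Measure X}
    {m : ℕ} (hm : 0 < m) (ξ : Fin m → X) (F : X → ℝ) (hF : Integrable F μ) :
    ∫ x, F x ∂(sampleMeasure μ ξ) = 1 / 2 * (∫ x, F x ∂μ) + 1 / 2 * ((m : ℝ)⁻¹ * ∑ j, F (ξ j)) := by
  unfold sampleMeasure
  have h2m : (2 * m : ℝ≥0∞) ≠ 0 := by
    have : (m : ℝ≥0∞) ≠ 0 := by exact_mod_cast hm.ne'
    simp [this]
  have hd : ∀ j ∈ (Finset.univ : Finset (Fin m)), Integrable F (Measure.dirac (ξ j)) := fun j _ =>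
    integrable_dirac (by simp)
  rw [integral_add_measure, integral_smul_measure, integral_smul_measure,
    integral_finsetSum_measure hd]
  · simp only [integral_dirac]
    simp [ENNReal.toReal_inv, ENNReal.toReal_mul]
    ring
  · exact hF.smul_measure (by simp)
  · refine Integrable.smul_measure ?_ (by simpa using h2m)
    exact (integrable_finsetSum_measure).2 hd

lemma aux_final {X : Type*} [MeasurableSpace X] [MeasurableSingletonClass X] {μ : Measure X}
    [IsProbabilityMeasure μ] {N : ℕ} {g : Fin N → X → ℂ} {b : ℝ} (h : AuxONS μ g b) (p : ℝ)
    (hp : 1 < p) (hp2 : p ≤ 2) {m : ℕ} (hm : 0 < m) (ξ : Fin m → X) (u v : ℕ)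
    (hdisc : ∀ (S : Finset (Fin N)) (c : Fin N → ℂ), S.card ≤ u + v →
      ∫ x, ‖auxF g S c x‖ ^ p ∂μ ≤ 16384 * ((m : ℝ)⁻¹ * ∑ j, ‖auxF g S c (ξ j)‖ ^ p))
    (f0 : X → ℂ) (hf0 : Measurable f0) (F : ℝ) (hF : ∀ x, ‖f0 x‖ ≤ F)
    (S : Finset (Fin N)) (c : Fin N → ℂ) (hS : S.card ≤ u)
    (hw : ∀ (T : Finset (Fin N)) (x : Fin N → ℂ), T.card ≤ v →
      dNorm ξ p (f0 - auxF g S c) ≤ 4 * dNorm ξ p (f0 - auxF g T x)) :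
    SamplingRecovery.lpNorm μ p (f0 - auxF g S c) ≤
      327684 * sigmaErr (SamplingRecovery.lpNorm (sampleMeasure μ ξ) p) g v f0 := by
  have hp0 : 0 < p := by linarith
  have hip : 0 ≤ 1 / p := by positivity
  have hip1 : 1 / p ≤ 1 := by rw [div_le_one hp0]; linarith
  have hint : ∀ (T : Finset (Fin N)) (x : Fin N → ℂ),
      Integrable (fun y => ‖(f0 - auxF g T x) y‖ ^ p) μ := by
    intro T x
    have hme : Measurable (fun y => ‖(f0 - auxF g T x) y‖ ^ p) :=
      ((hf0.sub (h.measF T x)).norm).pow_const p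
    refine Integrable.of_bound hme.aestronglyMeasurable ((F + b * ∑ i ∈ T, ‖x i‖) ^ p)
      (Filter.Eventually.of_forall fun y => ?_)
    rw [Real.norm_of_nonneg (by positivity)]
    refine Real.rpow_le_rpow (norm_nonneg _) ?_ hp0.le
    refine (norm_sub_le _ _).trans ?_
    exact add_le_add (hF y) (auxF_bdd h.bdd T x y)
  unfold sigmaErr
  rw [← div_le_iff₀' (by norm_num)]
  refine le_csInf ⟨_, _, ⟨∅, 0, by simp, rfl⟩, rfl⟩ ?_
  rintro _ ⟨_, ⟨T, x, hT, rfl⟩, rfl⟩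
  change _ ≤ SamplingRecovery.lpNorm (sampleMeasure μ ξ) p (f0 - auxF g T x)
  rw [div_le_iff₀' (by norm_num)]
  set e := SamplingRecovery.lpNorm (sampleMeasure μ ξ) p (f0 - auxF g T x) with he
  set E := ∫ y, ‖(f0 - auxF g T x) y‖ ^ p ∂(sampleMeasure μ ξ) with hE
  have heE : e = E ^ (1 / p) := rfl
  have hE0 : 0 ≤ E := integral_nonneg fun y => by positivity
  have hsam := aux_sample hm ξ _ (hint T x)
  rw [← hE] at hsam
  set x1 := ∫ y, ‖(f0 - auxF g T x) y‖ ^ p ∂μ with hx1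
  set d1 := (m : ℝ)⁻¹ * ∑ j, ‖(f0 - auxF g T x) (ξ j)‖ ^ p with hd1
  have hx10 : 0 ≤ x1 := integral_nonneg fun y => by positivity
  have hd10 : 0 ≤ d1 := by positivity
  have hx1e : x1 ^ (1 / p) ≤ 2 * e := by
    rw [heE]
    refine le_trans ?_ (aux_rpow_le 2 E p (by norm_num) hE0 hp)
    exact Real.rpow_le_rpow hx10 (by linarith) hip
  have hd1e : dNorm ξ p (f0 - auxF g T x) ≤ 2 * e := by
    rw [heE]
    refine le_trans ?_ (aux_rpow_le 2 E p (by norm_num) hE0 hp)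
    exact Real.rpow_le_rpow hd10 (by linarith) hip
  have hNm := aux_dNorm ξ p hp hp2
  have hw' := hw T x hT
  obtain ⟨dd, hdd⟩ := auxF_sub g T S x c
  have hdn : dNorm ξ p (auxF g (T ∪ S) dd) ≤ 10 * e := by
    rw [← hdd]
    have e1 : auxF g T x - auxF g S c = (f0 - auxF g S c) - (f0 - auxF g T x) := by
      ext y; simp
    rw [e1]
    have := hNm.sub (f0 - auxF g S c) (f0 - auxF g T x)
    linarith
  set y1 := ∫ y, ‖auxF g (T ∪ S) dd y‖ ^ p ∂μ with hy1
  have hy10 : 0 ≤ y1 := integral_nonneg fun y => by positivity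
  have hy1e : y1 ^ (1 / p) ≤ 163840 * e := by
    have h1 : y1 ^ (1 / p) ≤ 16384 * dNorm ξ p (auxF g (T ∪ S) dd) := by
      refine le_trans ?_ (aux_rpow_le 16384 _ p (by norm_num) (by positivity) hp)
      refine Real.rpow_le_rpow hy10 (hdisc _ _ ?_) hip
      exact (Finset.card_union_le _ _).trans (by omega)
    linarith
  have hsum : ∫ y, ‖(f0 - auxF g S c) y‖ ^ p ∂μ ≤ 2 * (x1 + y1) := by
    have hi2 := h.intF (T ∪ S) dd p hp0.le
    calc ∫ y, ‖(f0 - auxF g S c) y‖ ^ p ∂μ ≤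
        ∫ y, (2 * ‖(f0 - auxF g T x) y‖ ^ p + 2 * ‖auxF g (T ∪ S) dd y‖ ^ p) ∂μ := by
          refine integral_mono (hint S c) (((hint T x).const_mul 2).add (hi2.const_mul 2)) ?_
          intro y
          have e1 := aux_clark_pt p hp0 hp2 ((f0 - auxF g T x) y) (auxF g (T ∪ S) dd y)
          have e2 : (f0 - auxF g S c) y = (f0 - auxF g T x) y + auxF g (T ∪ S) dd y := by
            rw [← hdd]; simp
          have e3 : 0 ≤ ‖(f0 - auxF g T x) y - auxF g (T ∪ S) dd y‖ ^ p := by positivity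
          show ‖(f0 - auxF g S c) y‖ ^ p ≤ _
          rw [e2]
          linarith
      _ = 2 * (x1 + y1) := by
          rw [integral_add ((hint T x).const_mul 2) (hi2.const_mul 2), integral_const_mul,
            integral_const_mul]; ring
  calc SamplingRecovery.lpNorm μ p (f0 - auxF g S c) ≤ (2 * (x1 + y1)) ^ (1 / p) :=
        Real.rpow_le_rpow (integral_nonneg fun y => by positivity) hsum hip
    _ ≤ 2 * (x1 + y1) ^ (1 / p) := aux_rpow_le 2 _ p (by norm_num) (by positivity) hp
    _ ≤ 2 * (x1 ^ (1 / p) + y1 ^ (1 / p)) := by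
        refine mul_le_mul_of_nonneg_left ?_ (by norm_num)
        exact Real.rpow_add_le_add_rpow hx10 hy10 hip hip1
    _ ≤ 327684 * e := by linarith

lemma aux_span {X : Type*} {N : ℕ} (g : Fin N → X → ℂ) (φ : ℕ → Fin N) (k : ℕ) (f : X → ℂ)
    (hf : f ∈ Submodule.span ℂ ((fun j => g (φ j)) '' Set.Iic k)) :
    ∃ (S : Finset (Fin N)) (c : Fin N → ℂ), S.card ≤ k + 1 ∧ f = auxF g S c := by
  refine ⟨(Finset.range (k + 1)).image φ, ?_⟩
  have h1 : ((fun j => g (φ j)) '' Set.Iic k) =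
      g '' (((Finset.range (k + 1)).image φ : Finset (Fin N)) : Set (Fin N)) := by
    ext y
    simp only [Set.mem_image, Set.mem_Iic, Finset.coe_image, Finset.coe_range, Set.mem_Iio]
    constructor
    · rintro ⟨j, hj, rfl⟩
      exact ⟨φ j, ⟨j, by omega, rfl⟩, rfl⟩
    · rintro ⟨_, ⟨j, hj, rfl⟩, rfl⟩
      exact ⟨j, by omega, rfl⟩
  rw [h1, Submodule.mem_span_image_finset_iff_exists_fun] at hf
  obtain ⟨c, hc⟩ := hf
  refine ⟨fun i => if hi : i ∈ (Finset.range (k + 1)).image φ then c ⟨i, hi⟩ else 0,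
    Finset.card_image_le.trans (by simp), ?_⟩
  rw [← hc, Finset.univ_eq_attach]
  ext y
  unfold auxF
  rw [← Finset.sum_attach ((Finset.range (k + 1)).image φ), Finset.sum_apply]
  refine Finset.sum_congr rfl fun i _ => ?_
  simp [i.2]

/-- under the hypotheses of the WCGA recovery theorem for uniformly bounded
orthonormal systems (`1 < p ≤ 2`), the residual after `u` iterations satisfies
`‖f_u‖_{L_p(Ω,μ)} ≤ C' σ_v(f_0, D_N)_{L_p(Ω,μ_ξ)}` with `μ_ξ = (μ + μ_m)/2` and `C'` a
positive absolute constant. -/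
theorem wcga_orthonormal_recovery_sampleMeasure :
    ∃ C' : ℝ, 0 < C' ∧
    ∃ V : ℝ → ℝ, (∀ B, 0 < B → 0 < V B) ∧
    ∃ c : ℝ → ℝ → ℝ, (∀ t p, 1 ≤ c t p) ∧
    ∃ Cc : ℝ → ℝ → ℝ,
    ∀ B : ℝ, 0 < B →
    ∀ p t : ℝ, 1 < p → p ≤ 2 → 0 < t → t ≤ 1 →
    ∀ (d : ℕ) (Ω : Set (Fin d → ℝ)), IsCompact Ω →
    ∀ μ : Measure Ω, IsProbabilityMeasure μ →
    ∀ (N : ℕ) (g : Fin N → Ω → ℂ), (∀ i, Continuous (g i)) →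
      (∀ i x, ‖g i x‖ ≤ B) →
      (∀ i j, ∫ x, g i x * (starRingEnd ℂ) (g j x) ∂μ = if i = j then 1 else 0) →
    ∀ v : ℕ, 0 < v → uONS (c t p) (V B) p v ≤ N →
    ∃ (m : ℕ) (ξ : Fin m → Ω),
      (m : ℝ) ≤ Cc p B * (uONS (c t p) (V B) p v : ℝ) * Real.log N *
          (Real.log (2 * (uONS (c t p) (V B) p v : ℝ))) ^ 2 *
          (Real.log (2 * (uONS (c t p) (V B) p v : ℝ)) + Real.log (Real.log N)) ∧
      ∀ f0 : Ω → ℂ, Continuous f0 →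
      ∀ (φ : ℕ → Fin N) (G : ℕ → Ω → ℂ),
        IsWCGA g (dNorm ξ p) t f0 φ G →
        lpNorm μ p (f0 - G (uONS (c t p) (V B) p v)) ≤
          C' * sigmaErr (lpNorm (sampleMeasure μ ξ) p) g v f0 := by
  refine ⟨327684, by norm_num, fun B => 131072 * (max B 1) ^ 2, fun B _ => by positivity,
    auxC, fun t p => le_max_left _ _,
    fun _ B => 2 * (1024 * 49 * 65536 * 1024 * 28) * (max B 1) ^ 4, ?_⟩
  intro B hB p t hp hp2 ht ht1 d Ω hΩ μ hμ N g hgc hgB horth v hv huN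
  set b := max B 1 with hb
  have hb1 : 1 ≤ b := le_max_right _ _
  have hgb : ∀ i x, ‖g i x‖ ≤ b := fun i x => (hgB i x).trans (le_max_left _ _)
  have hons : AuxONS μ g b := ⟨fun i => (hgc i).measurable, hb1, hgb, horth⟩
  obtain ⟨hvu, hbu, hS⟩ := aux_u b p t hb1 hp hp2 ht v hv
  simp only at huN ⊢
  set u := uONS (auxC t p) (131072 * b ^ 2) p v with hu
  obtain ⟨M, K, m, hM0, hK0, hm0, hM, hK, hm, hmb⟩ := aux_params b hb1 u v N hv hvu huN hbu
  obtain ⟨ξ, hξ⟩ := hons.disc p hp hp2 (by omega) (u + v) M (by omega) hM0 hM K m hK0 hK hm0 hm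
  refine ⟨m, ξ, hmb, ?_⟩
  intro f0 hf0 φ G hW
  have hp0 : 0 < p := by linarith
  have hv1 : (1 : ℝ) ≤ v := by exact_mod_cast hv
  have hInc : Incoherent g v (u + v) (16384 * b) (1 / p) (dNorm ξ p) := by
    intro A T hAT hA hT c
    refine (hons.inc p hp hp2 T A hAT c).trans ?_
    have e1 : (∫ x, ‖auxF g T c x‖ ^ p ∂μ) ^ (1 / p) ≤ 16384 * dNorm ξ p (auxF g T c) := by
      refine le_trans ?_ (aux_rpow_le 16384 _ p (by norm_num) (by positivity) hp)
      exact Real.rpow_le_rpow (integral_nonneg fun x => by positivity) (hξ T c hT) (by positivity)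
    calc b * (A.card : ℝ) ^ (1 / p) * (∫ x, ‖auxF g T c x‖ ^ p ∂μ) ^ (1 / p) ≤
        b * (A.card : ℝ) ^ (1 / p) * (16384 * dNorm ξ p (auxF g T c)) := by gcongr
      _ = 16384 * b * (A.card : ℝ) ^ (1 / p) * dNorm ξ p (auxF g T c) := by ring
  have hb2 : 1 ≤ b ^ 2 := one_le_pow₀ hb1
  have hD1 : 1 < 2 * (131072 * b ^ 2) * (v : ℝ) := by nlinarith
  have hD : 8 * (16384 * b * (v : ℝ) ^ (1 / p)) * b < 2 * (131072 * b ^ 2) * (v : ℝ) := by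
    have h1 : (v : ℝ) ^ (1 / p) ≤ v := by
      calc (v : ℝ) ^ (1 / p) ≤ (v : ℝ) ^ (1 : ℝ) := by
            refine Real.rpow_le_rpow_of_exponent_le hv1 ?_
            rw [div_le_one hp0]; linarith
        _ = v := Real.rpow_one _
    have h2 : b ^ 2 * (v : ℝ) ^ (1 / p) ≤ b ^ 2 * v := by gcongr
    nlinarith
  obtain ⟨S, c, hSc, hGu⟩ : ∃ (S : Finset (Fin N)) (c : Fin N → ℂ), S.card ≤ u ∧
      G u = auxF g S c := by
    obtain ⟨k, hk⟩ : ∃ k, u = k + 1 := ⟨u - 1, by omega⟩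
    rw [hk]
    exact aux_span g φ k _ (hW.2 k).2.1
  haveI : CompactSpace Ω := isCompact_iff_compactSpace.mp hΩ
  obtain ⟨F, hF⟩ := (isCompact_range hf0.norm).bddAbove
  rw [hGu]
  refine aux_final hons p hp hp2 hm0 ξ u v hξ f0 hf0.measurable F
    (fun x => hF ⟨x, rfl⟩) S c hSc ?_
  intro T x hT
  rw [← hGu]
  have := aux_wcga (aux_dNorm ξ p hp hp2) hp hp2 t ht g f0 φ G hW b (by linarith)
    (fun i => aux_dNorm_le ξ p hp _ b (by linarith) (hgb i)) v u (16384 * b) hv (by positivity)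
    hInc (2 * (131072 * b ^ 2) * v) hD1 hD hS T hT x
  have e : ∑ i ∈ T, x i • g i = auxF g T x := by
    ext y; simp [auxF, Finset.sum_apply]
  rwa [e] at this
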